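/- Suppose p,q are coprime positive integers and θ ∈ (0,π/3) satisfies tan θ = √3·p/(2q+p). Then there is a constant α(θ), depending only on θ, such that for Lebesgue-almost all a ∈ Δ_θ the box dimension and the Hausdorff dimension of the slice E_{θ,a} both exist, coincide, and equal α(θ), and moreover α(θ) < s − 1. -/

import Mathlib

open Filter MeasureTheory Set Metric Topology
open scoped ENNReal Classical

noncomputable section

/-- The maps of the iterated function system of the usual Sierpiński gasket. -/
def gasketMap : Fin 3 → ℝ × ℝ → ℝ × ℝ
  | 0 => fun z => (z.1 / 2, z.2 / 2)
  | 1 => fun z => (z.1 / 2 + 1 / 2, z.2 / 2)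
  | 2 => fun z => (z.1 / 2 + 1 / 4, z.2 / 2 + Real.sqrt 3 / 4)

/-- `Δ` is the Sierpiński gasket: the unique nonempty compact set invariant under the IFS. -/
def IsSierpinskiGasket (Δ : Set (ℝ × ℝ)) : Prop :=
  Δ.Nonempty ∧ IsCompact Δ ∧
    Δ = gasketMap 0 '' Δ ∪ gasketMap 1 '' Δ ∪ gasketMap 2 '' Δ

/-- The orthogonal projection onto the line through the origin making angle `θ` with the
`x`-axis, expressed as the real coordinate along that line. -/
def projAngle (θ : ℝ) (z : ℝ × ℝ) : ℝ := z.1 * Real.cos θ + z.2 * Real.sin θ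

/-- The slice `E_{θ,a}`. -/
def sliceSet (Δ : Set (ℝ × ℝ)) (θ a : ℝ) : Set (ℝ × ℝ) :=
  {z ∈ Δ | projAngle θ z = a}

/-- Minimal number of `ε`-balls needed to cover `E` (junk value `0` if there is no
finite cover). -/
def coverNum {X : Type*} [PseudoMetricSpace X] (E : Set X) (ε : ℝ) : ℕ :=
  sInf {n : ℕ | ∃ F : Finset X, F.card = n ∧ E ⊆ ⋃ x ∈ F, Metric.ball x ε}

/-- Lower box (Minkowski) dimension. -/
def lowerBoxDim {X : Type*} [PseudoMetricSpace X] (E : Set X) : ℝ :=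
  liminf (fun ε : ℝ => Real.log (coverNum E ε) / Real.log (1 / ε)) (𝓝[>] 0)

/-- Upper box (Minkowski) dimension. -/
def upperBoxDim {X : Type*} [PseudoMetricSpace X] (E : Set X) : ℝ :=
  limsup (fun ε : ℝ => Real.log (coverNum E ε) / Real.log (1 / ε)) (𝓝[>] 0)

/-- Lower local dimension of a measure at a point. -/
def lowerLocalDim (η : Measure ℝ) (x : ℝ) : ℝ :=
  liminf (fun r : ℝ => Real.log (η (Metric.ball x r)).toReal / Real.log r) (𝓝[>] 0)

/-- Upper local dimension of a measure at a point. -/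
def upperLocalDim (η : Measure ℝ) (x : ℝ) : ℝ :=
  limsup (fun r : ℝ => Real.log (η (Metric.ball x r)).toReal / Real.log r) (𝓝[>] 0)

/-- `ν` is the natural self-similar measure on the Sierpiński gasket `Δ`, i.e. the unique
Borel probability measure with `ν = Σ_{i=0}^2 (1/3) ν ∘ S_i⁻¹` (supported on `Δ`). -/
def IsGasketMeasure (Δ : Set (ℝ × ℝ)) (ν : Measure (ℝ × ℝ)) : Prop :=
  IsProbabilityMeasure ν ∧ ν Δᶜ = 0 ∧
    ν = (3 : ℝ≥0∞)⁻¹ • (ν.map (gasketMap 0) + ν.map (gasketMap 1) + ν.map (gasketMap 2))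

/-- Hausdorff dimension of a measure: `inf {dim_H A : η A = 1}`. -/
def measureDimH (η : Measure ℝ) : ℝ≥0∞ :=
  sInf {d : ℝ≥0∞ | ∃ A : Set ℝ, η A = 1 ∧ dimH A = d}

/-- The matrices `A_0, A_1` of the paper (there rows and columns are indexed by
`1, …, p+q`; here `i : Fin (p+q)` corresponds to the row `i+1`). -/
def gmA (p q : ℕ) (n : ℕ) : Matrix (Fin (p + q)) (Fin (p + q)) ℝ :=
  Matrix.of fun i j =>
    if Int.ModEq ((p : ℤ) + (q : ℤ)) (2 * ((i : ℤ) + 1) + 1 - (n : ℤ)) ((j : ℤ) + 1) ∨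
        (((q : ℤ) + 1 ≤ 2 * ((i : ℤ) + 1) + (n : ℤ) - 1 ∧
            2 * ((i : ℤ) + 1) + (n : ℤ) - 1 ≤ 2 * (q : ℤ) + (p : ℤ)) ∧
          Int.ModEq ((p : ℤ) + (q : ℤ)) (2 * ((i : ℤ) + 1) + 1 - (n : ℤ) - (q : ℤ))
            ((j : ℤ) + 1))
    then 1 else 0

/-- The product `A_{ξ_1} ⋯ A_{ξ_n}` along a word `ξ ∈ {0,1}^n`. -/
def gmProd (p q : ℕ) {n : ℕ} (ξ : Fin n → Fin 2) : Matrix (Fin (p + q)) (Fin (p + q)) ℝ :=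
  (List.ofFn fun m => gmA p q (ξ m : ℕ)).prod

/-- `e ⬝ A_{ξ_1} ⋯ A_{ξ_n} ⬝ e` where `e = (1,…,1)`. -/
def eAe (p q : ℕ) {n : ℕ} (ξ : Fin n → Fin 2) : ℝ :=
  ∑ i : Fin (p + q), ∑ j : Fin (p + q), gmProd p q ξ i j

/-- `e_k ⬝ A_{ξ_1} ⋯ A_{ξ_n} ⬝ e` where `e_k` is the `k`-th standard basis vector. -/
def ekAe (p q : ℕ) {n : ℕ} (k : Fin (p + q)) (ξ : Fin n → Fin 2) : ℝ :=
  ∑ j : Fin (p + q), gmProd p q ξ k j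

/-- The maps of the IFS of the right-angle Sierpiński gasket. -/
def rgasketMap : Fin 3 → ℝ × ℝ → ℝ × ℝ
  | 0 => fun z => (z.1 / 2, z.2 / 2)
  | 1 => fun z => (z.1 / 2 + 1 / 2, z.2 / 2)
  | 2 => fun z => (z.1 / 2, z.2 / 2 + 1 / 2)

/-- `Λ` is the right-angle Sierpiński gasket. -/
def IsRightGasket (Λ : Set (ℝ × ℝ)) : Prop :=
  Λ.Nonempty ∧ IsCompact Λ ∧
    Λ = rgasketMap 0 '' Λ ∪ rgasketMap 1 '' Λ ∪ rgasketMap 2 '' Λ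

/-- The slice of the right-angle gasket by the line `y = a + (p/q) x`. -/
def rslice (Λ : Set (ℝ × ℝ)) (p q : ℕ) (a : ℝ) : Set (ℝ × ℝ) :=
  {z ∈ Λ | z.2 = a + ((p : ℝ) / (q : ℝ)) * z.1}

/-- The cylinder set `Δ_{i_1 ⋯ i_n} = S_{i_1} ∘ ⋯ ∘ S_{i_n}(Δ)`. -/
def cylSet (Δ : Set (ℝ × ℝ)) {n : ℕ} (w : Fin n → Fin 3) : Set (ℝ × ℝ) :=
  (List.ofFn fun m => gasketMap (w m)).foldr (fun f E => f '' E) Δ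



/-- The digit sets `{0, d 1, d 2}` with largest element `M` and greatest common divisor one. -/
structure IsDigitSystem (d : Fin 3 → ℕ) (M : ℕ) : Prop where
  zero : d 0 = 0
  le : ∀ i, d i ≤ M
  pos : 0 < M
  top : ∃ i, d i = M
  coprime : ∃ i, Nat.Coprime (d i) M

/-- The iterated transfer operator `F ↦ ∑ i, F (2 y - d i)`. -/
def transferOp (d : Fin 3 → ℕ) : ℕ → (ℝ → ℝ) → ℝ → ℝ
  | 0, F => F
  | n + 1, F => fun y => ∑ i, transferOp d n F (2 * y - d i)

/-- The indicator function of `[0, M)`. -/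
def baseInd (M : ℕ) (y : ℝ) : ℝ := if 0 ≤ y ∧ y < M then 1 else 0

/-- The number of words of length `n` whose cylinder is hit by the slice at height `y`. -/
def cylCount (d : Fin 3 → ℕ) (M n : ℕ) (y : ℝ) : ℝ := transferOp d n (baseInd M) y

/-- The total of `cylCount` over the integer translates of `y` in `[0, M)`. -/
def fiberSum (d : Fin 3 → ℕ) (M n : ℕ) (y : ℝ) : ℝ :=
  ∑ j ∈ Finset.range M, cylCount d M n (j + Int.fract y)

/-- The minimum of `cylCount` over the integer translates of `y` in `[0, M)`. -/
def fiberMin (d : Fin 3 → ℕ) (M n : ℕ) (y : ℝ) : ℝ :=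
  ⨅ j : Fin M, cylCount d M n ((j : ℕ) + Int.fract y)

section Counting

variable {d : Fin 3 → ℕ} {M : ℕ}

lemma transferOp_add (m n : ℕ) (F : ℝ → ℝ) :
    transferOp d (m + n) F = transferOp d m (transferOp d n F) := by
  induction m with
  | zero => simp [transferOp]
  | succ m ih => rw [Nat.succ_add]; simp only [transferOp, ih]

lemma transferOp_mono (n : ℕ) {F G : ℝ → ℝ} (y : ℝ)
    (h : ∀ m : ℤ, F (2 ^ n * y + m) ≤ G (2 ^ n * y + m)) :
    transferOp d n F y ≤ transferOp d n G y := by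
  induction n generalizing y with
  | zero => simpa [transferOp] using h 0
  | succ n ih =>
    refine Finset.sum_le_sum fun i _ => ih _ fun m => ?_
    have := h (m - 2 ^ n * d i)
    convert this using 2 <;> push_cast <;> ring

lemma transferOp_const_mul (n : ℕ) (C : ℝ) (F : ℝ → ℝ) (y : ℝ) :
    transferOp d n (fun z => C * F z) y = C * transferOp d n F y := by
  induction n generalizing y with
  | zero => rfl
  | succ n ih => simp only [transferOp, ih, Finset.mul_sum]

lemma transferOp_nonneg (n : ℕ) {F : ℝ → ℝ} (hF : ∀ z, 0 ≤ F z) (y : ℝ) :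
    0 ≤ transferOp d n F y := by
  induction n generalizing y with
  | zero => exact hF y
  | succ n ih => exact Finset.sum_nonneg fun i _ => ih _

lemma measurable_transferOp (n : ℕ) {F : ℝ → ℝ} (hF : Measurable F) :
    Measurable (transferOp d n F) := by
  induction n with
  | zero => exact hF
  | succ n ih =>
    simp only [transferOp]
    exact Finset.measurable_sum _ fun i _ => ih.comp (by fun_prop)

lemma measurable_baseInd : Measurable (baseInd M) :=
  Measurable.ite (measurableSet_Ico (a := (0 : ℝ)) (b := M)) measurable_const measurable_const

lemma baseInd_nonneg (y : ℝ) : 0 ≤ baseInd M y := by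
  unfold baseInd; split_ifs <;> simp

lemma measurable_cylCount (n : ℕ) : Measurable (cylCount d M n) :=
  measurable_transferOp n measurable_baseInd

lemma cylCount_nonneg (n : ℕ) (y : ℝ) : 0 ≤ cylCount d M n y :=
  transferOp_nonneg n baseInd_nonneg y

lemma cylCount_succ (n : ℕ) (y : ℝ) :
    cylCount d M (n + 1) y = ∑ i, cylCount d M n (2 * y - d i) := rfl

lemma cylCount_add (m n : ℕ) (y : ℝ) :
    cylCount d M (m + n) y = transferOp d m (cylCount d M n) y := by
  unfold cylCount
  rw [transferOp_add]

lemma cylCount_le (n : ℕ) (y : ℝ) : cylCount d M n y ≤ 3 ^ n := by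
  induction n generalizing y with
  | zero => simp only [cylCount, transferOp, baseInd]; split_ifs <;> simp
  | succ n ih =>
    rw [cylCount_succ]
    calc ∑ i, cylCount d M n (2 * y - d i) ≤ ∑ _i : Fin 3, (3 : ℝ) ^ n :=
          Finset.sum_le_sum fun i _ => ih _
      _ = 3 ^ (n + 1) := by simp; ring

lemma cylCount_eq_zero (hd : IsDigitSystem d M) (n : ℕ) {y : ℝ} (hy : ¬ (0 ≤ y ∧ y < M)) :
    cylCount d M n y = 0 := by
  induction n generalizing y with
  | zero => simp [cylCount, transferOp, baseInd, hy]
  | succ n ih =>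
    rw [cylCount_succ]
    refine Finset.sum_eq_zero fun i _ => ih ?_
    rintro ⟨h1, h2⟩
    have hi : (d i : ℝ) ≤ M := by exact_mod_cast hd.le i
    have hi0 : (0 : ℝ) ≤ d i := by positivity
    exact hy ⟨by linarith, by linarith⟩

lemma one_le_cylCount (hd : IsDigitSystem d M) (n : ℕ) {y : ℝ} (h0 : 0 ≤ y) (hM : y < M) :
    1 ≤ cylCount d M n y := by
  induction n generalizing y with
  | zero => simp [cylCount, transferOp, baseInd, h0, hM]
  | succ n ih =>
    rw [cylCount_succ]
    obtain ⟨i, h1, h2⟩ : ∃ i, 0 ≤ 2 * y - d i ∧ 2 * y - d i < M := by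
      by_cases h : 2 * y < M
      · exact ⟨0, by simp [hd.zero]; linarith, by simpa [hd.zero] using h⟩
      · obtain ⟨i, hi⟩ := hd.top
        exact ⟨i, by rw [hi]; linarith, by rw [hi]; linarith⟩
    exact (ih h1 h2).trans
      (Finset.single_le_sum (f := fun i => cylCount d M n (2 * y - d i))
        (fun i _ => cylCount_nonneg n _) (Finset.mem_univ i))

lemma fiberSum_add_int (n : ℕ) (y : ℝ) (m : ℤ) : fiberSum d M n (y + m) = fiberSum d M n y := by
  simp [fiberSum]

lemma fiberMin_add_int (n : ℕ) (y : ℝ) (m : ℤ) : fiberMin d M n (y + m) = fiberMin d M n y := by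
  simp [fiberMin]

lemma measurable_fiberSum (n : ℕ) : Measurable (fiberSum d M n) := by
  unfold fiberSum
  exact Finset.measurable_sum _ fun j _ =>
    (measurable_cylCount n).comp (measurable_const.add measurable_fract)

lemma measurable_fiberMin (n : ℕ) : Measurable (fiberMin d M n) := by
  unfold fiberMin
  exact Measurable.iInf fun j =>
    (measurable_cylCount n).comp (measurable_const.add measurable_fract)

lemma exists_eq_add_fract {y : ℝ} (h0 : 0 ≤ y) (hM : y < M) :
    ∃ j : Fin M, y = (j : ℕ) + Int.fract y := by
  have h1 : 0 ≤ ⌊y⌋ := Int.floor_nonneg.mpr h0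
  have h2 : ((⌊y⌋.toNat : ℕ) : ℤ) = ⌊y⌋ := Int.toNat_of_nonneg h1
  have h3 : ⌊y⌋ < M := by rw [Int.floor_lt]; exact_mod_cast hM
  refine ⟨⟨⌊y⌋.toNat, by omega⟩, ?_⟩
  have : ((⌊y⌋.toNat : ℕ) : ℝ) = ((⌊y⌋ : ℤ) : ℝ) := by exact_mod_cast h2
  simp only [this, Int.floor_add_fract]

lemma cylCount_le_fiberSum (hd : IsDigitSystem d M) (n : ℕ) (y : ℝ) :
    cylCount d M n y ≤ fiberSum d M n y := by
  by_cases hy : 0 ≤ y ∧ y < M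
  · obtain ⟨j, hj⟩ := exists_eq_add_fract hy.1 hy.2
    conv_lhs => rw [hj]
    exact Finset.single_le_sum (f := fun j : ℕ => cylCount d M n (j + Int.fract y))
      (fun i _ => cylCount_nonneg n _) (Finset.mem_range.mpr j.2)
  · rw [cylCount_eq_zero hd n hy]
    exact Finset.sum_nonneg fun i _ => cylCount_nonneg n _

lemma fiberMin_le_cylCount (n : ℕ) {y : ℝ} (h0 : 0 ≤ y) (hM : y < M) :
    fiberMin d M n y ≤ cylCount d M n y := by
  obtain ⟨j, hj⟩ := exists_eq_add_fract h0 hM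
  conv_rhs => rw [hj]
  exact ciInf_le (Set.finite_range _).bddBelow j

lemma natCast_add_fract_mem {j : ℕ} (hj : j < M) (y : ℝ) :
    0 ≤ (j : ℝ) + Int.fract y ∧ (j : ℝ) + Int.fract y < M := by
  have h1 := Int.fract_nonneg y
  have h2 := Int.fract_lt_one y
  have h3 : (j : ℝ) + 1 ≤ M := by exact_mod_cast hj
  exact ⟨by positivity, by linarith⟩

lemma one_le_fiberMin (hd : IsDigitSystem d M) (n : ℕ) (y : ℝ) : 1 ≤ fiberMin d M n y := by
  have : Nonempty (Fin M) := ⟨⟨0, hd.pos⟩⟩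
  exact le_ciInf fun j => one_le_cylCount hd n (natCast_add_fract_mem j.2 y).1
    (natCast_add_fract_mem j.2 y).2

lemma fiberMin_le_fiberSum (hd : IsDigitSystem d M) (n : ℕ) (y : ℝ) :
    fiberMin d M n y ≤ fiberSum d M n y := by
  have h := natCast_add_fract_mem hd.pos y
  have h1 := fiberMin_le_cylCount (d := d) n h.1 h.2
  have h2 := cylCount_le_fiberSum hd n (((0 : ℕ) : ℝ) + Int.fract y)
  have h3 : Int.fract (((0 : ℕ) : ℝ) + Int.fract y) = Int.fract y := by simp
  have h4 : fiberMin d M n (((0 : ℕ) : ℝ) + Int.fract y) = fiberMin d M n y := by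
    unfold fiberMin; rw [h3]
  have h5 : fiberSum d M n (((0 : ℕ) : ℝ) + Int.fract y) = fiberSum d M n y := by
    unfold fiberSum; rw [h3]
  linarith

lemma one_le_fiberSum (hd : IsDigitSystem d M) (n : ℕ) (y : ℝ) : 1 ≤ fiberSum d M n y :=
  (one_le_fiberMin hd n y).trans (fiberMin_le_fiberSum hd n y)

lemma fiberSum_le (n : ℕ) (y : ℝ) : fiberSum d M n y ≤ M * 3 ^ n := by
  calc fiberSum d M n y ≤ ∑ _j ∈ Finset.range M, (3 : ℝ) ^ n :=
        Finset.sum_le_sum fun j _ => cylCount_le n _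
    _ = M * 3 ^ n := by simp

lemma cylCount_add_le (hd : IsDigitSystem d M) (m n : ℕ) (y : ℝ) :
    cylCount d M (m + n) y ≤ cylCount d M m y * fiberSum d M n (2 ^ m * y) := by
  rw [cylCount_add, mul_comm, cylCount, ← transferOp_const_mul]
  refine transferOp_mono m y fun k => ?_
  by_cases hz : 0 ≤ 2 ^ m * y + (k : ℝ) ∧ 2 ^ m * y + (k : ℝ) < M
  · rw [baseInd, if_pos hz, mul_one, ← fiberSum_add_int n (2 ^ m * y) k]
    exact cylCount_le_fiberSum hd n _
  · rw [cylCount_eq_zero hd n hz, baseInd, if_neg hz, mul_zero]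

lemma le_cylCount_add (m n : ℕ) (y : ℝ) :
    cylCount d M m y * fiberMin d M n (2 ^ m * y) ≤ cylCount d M (m + n) y := by
  rw [cylCount_add, mul_comm, cylCount, ← transferOp_const_mul]
  refine transferOp_mono m y fun k => ?_
  by_cases hz : 0 ≤ 2 ^ m * y + (k : ℝ) ∧ 2 ^ m * y + (k : ℝ) < M
  · rw [baseInd, if_pos hz, mul_one, ← fiberMin_add_int n (2 ^ m * y) k]
    exact fiberMin_le_cylCount n hz.1 hz.2
  · rw [baseInd, if_neg hz, mul_zero]
    exact cylCount_nonneg n _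

lemma two_pow_mul_add_fract (m : ℕ) (j : ℕ) (y : ℝ) :
    2 ^ m * ((j : ℝ) + Int.fract y) = 2 ^ m * y + ((2 ^ m * (j - ⌊y⌋) : ℤ) : ℝ) := by
  have := Int.floor_add_fract y
  push_cast
  linear_combination 2 ^ m * this

lemma fiberSum_add_le (hd : IsDigitSystem d M) (m n : ℕ) (y : ℝ) :
    fiberSum d M (m + n) y ≤ fiberSum d M m y * fiberSum d M n (2 ^ m * y) := by
  rw [fiberSum, fiberSum, Finset.sum_mul]
  refine Finset.sum_le_sum fun j _ => (cylCount_add_le hd m n _).trans (le_of_eq ?_)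
  rw [two_pow_mul_add_fract, fiberSum_add_int]

lemma le_fiberMin_add (hd : IsDigitSystem d M) (m n : ℕ) (y : ℝ) :
    fiberMin d M m y * fiberMin d M n (2 ^ m * y) ≤ fiberMin d M (m + n) y := by
  have : Nonempty (Fin M) := ⟨⟨0, hd.pos⟩⟩
  refine le_ciInf fun j => le_trans ?_ (le_cylCount_add m n _)
  rw [two_pow_mul_add_fract, fiberMin_add_int]
  exact mul_le_mul_of_nonneg_right (ciInf_le (Set.finite_range _).bddBelow j)
    (zero_le_one.trans (one_le_fiberMin hd n _))

lemma transferOp_congr_floor (n : ℕ) {F : ℝ → ℝ} (hF : ∀ z z' : ℝ, ⌊z⌋ = ⌊z'⌋ → F z = F z')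
    {y y' : ℝ} (h : ⌊2 ^ n * y⌋ = ⌊2 ^ n * y'⌋) : transferOp d n F y = transferOp d n F y' := by
  induction n generalizing y y' with
  | zero => exact hF _ _ (by simpa using h)
  | succ n ih =>
    refine Finset.sum_congr rfl fun i _ => ih ?_
    have e : ∀ z : ℝ, 2 ^ n * (2 * z - d i) = 2 ^ (n + 1) * z - ((2 ^ n * d i : ℤ) : ℝ) := by
      intro z; push_cast; ring
    rw [e, e, Int.floor_sub_intCast, Int.floor_sub_intCast, h]

lemma cylCount_congr_floor (n : ℕ) {y y' : ℝ} (h : ⌊2 ^ n * y⌋ = ⌊2 ^ n * y'⌋) :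
    cylCount d M n y = cylCount d M n y' := by
  refine transferOp_congr_floor n (fun z z' hz => ?_) h
  have e : ∀ z : ℝ, (0 ≤ z ∧ z < M) ↔ (0 ≤ ⌊z⌋ ∧ ⌊z⌋ < M) := fun z => by
    rw [Int.floor_nonneg, Int.floor_lt]; norm_cast
  simp only [baseInd, e, hz]

lemma floor_two_pow_mul_add_fract (n j : ℕ) {y y' : ℝ} (h : ⌊2 ^ n * y⌋ = ⌊2 ^ n * y'⌋) :
    ⌊2 ^ n * ((j : ℝ) + Int.fract y)⌋ = ⌊2 ^ n * ((j : ℝ) + Int.fract y')⌋ := by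
  have h0 : ⌊y⌋ = ⌊y'⌋ := by
    have e : ∀ z : ℝ, ⌊z⌋ = ⌊2 ^ n * z⌋ / 2 ^ n := fun z => by
      have := Int.floor_div_natCast (2 ^ n * z) (2 ^ n)
      push_cast at this
      rw [← this, mul_div_cancel_left₀ _ (by positivity)]
    rw [e y, e y', h]
  rw [two_pow_mul_add_fract, two_pow_mul_add_fract, Int.floor_add_intCast, Int.floor_add_intCast,
    h, h0]

lemma fiberSum_congr_floor (n : ℕ) {y y' : ℝ} (h : ⌊2 ^ n * y⌋ = ⌊2 ^ n * y'⌋) :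
    fiberSum d M n y = fiberSum d M n y' :=
  Finset.sum_congr rfl fun j _ => cylCount_congr_floor n (floor_two_pow_mul_add_fract n j h)

lemma fiberMin_congr_floor (n : ℕ) {y y' : ℝ} (h : ⌊2 ^ n * y⌋ = ⌊2 ^ n * y'⌋) :
    fiberMin d M n y = fiberMin d M n y' :=
  iInf_congr fun j => cylCount_congr_floor n (floor_two_pow_mul_add_fract n j h)

end Counting


/-- One transition of the carry automaton: reading the bit `ξ` moves the state `j` to `j'`. -/
def CarryStep (d : Fin 3 → ℕ) (M : ℕ) (ξ : Fin 2) (j j' : ℕ) : Prop :=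
  j < M ∧ j' < M ∧ ∃ i, 2 * j + ξ = j' + d i

/-- Reading the word `w` can move the state `j` to `j'`. -/
def CarryReach (d : Fin 3 → ℕ) (M : ℕ) : List (Fin 2) → ℕ → ℕ → Prop
  | [], j, j' => j = j' ∧ j < M
  | ξ :: w, j, j' => ∃ k, CarryStep d M ξ j k ∧ CarryReach d M w k j'

section Automaton

variable {d : Fin 3 → ℕ} {M : ℕ}

lemma CarryReach.lt {w : List (Fin 2)} {j j' : ℕ} (h : CarryReach d M w j j') :
    j < M ∧ j' < M := by
  induction w generalizing j with
  | nil => obtain ⟨rfl, h⟩ := h; exact ⟨h, h⟩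
  | cons ξ w ih => obtain ⟨k, h1, h2⟩ := h; exact ⟨h1.1, (ih h2).2⟩

lemma CarryReach.append {w v : List (Fin 2)} {j k j' : ℕ} (h1 : CarryReach d M w j k)
    (h2 : CarryReach d M v k j') : CarryReach d M (w ++ v) j j' := by
  induction w generalizing j with
  | nil => obtain ⟨rfl, h⟩ := h1; exact h2
  | cons ξ w ih => obtain ⟨l, h3, h4⟩ := h1; exact ⟨l, h3, ih h4⟩

lemma carryStep_of_add_eq {y j' : ℕ} (hy : y < 2 * M) (hj : j' < M) (i : Fin 3)
    (h : y = j' + d i) : CarryStep d M ⟨y % 2, Nat.mod_lt _ two_pos⟩ (y / 2) j' :=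
  ⟨by omega, hj, i, by simp only; omega⟩

lemma exists_carryStep_to (hd : IsDigitSystem d M) {j' : ℕ} (hj : j' < M) (ξ : Fin 2) :
    ∃ j, CarryStep d M ξ j j' := by
  have hodd : ∃ i, d i % 2 = 1 := by
    obtain ⟨i, hi⟩ := hd.top
    obtain ⟨k, hk⟩ := hd.coprime
    by_contra! hcon
    have h1 : 2 ∣ d k := by have := hcon k; omega
    have h2 : 2 ∣ M := by have := hcon i; omega
    have := Nat.dvd_gcd h1 h2
    rw [hk] at this
    omega
  obtain ⟨i, hi⟩ : ∃ i, (j' + d i) % 2 = ξ := by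
    obtain ⟨i, hi⟩ := hodd
    by_cases h : j' % 2 = ξ
    · exact ⟨0, by simpa [hd.zero] using h⟩
    · exact ⟨i, by have := ξ.2; omega⟩
  have := carryStep_of_add_eq (y := j' + d i) (by have := hd.le i; omega) hj i rfl
  refine ⟨(j' + d i) / 2, ?_⟩
  convert this using 1
  exact Fin.ext hi.symm

lemma exists_carryStep_from (hd : IsDigitSystem d M) {j : ℕ} (hj : j < M) (ξ : Fin 2) :
    ∃ j', CarryStep d M ξ j j' := by
  have := ξ.2
  by_cases h : 2 * j + ξ < M
  · exact ⟨2 * j + ξ, hj, h, 0, by simp [hd.zero]⟩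
  · obtain ⟨i, hi⟩ := hd.top
    exact ⟨2 * j + ξ - M, hj, by omega, i, by omega⟩

lemma exists_carryReach_to (hd : IsDigitSystem d M) (w : List (Fin 2)) {j' : ℕ} (hj : j' < M) :
    ∃ j, CarryReach d M w j j' := by
  induction w with
  | nil => exact ⟨j', rfl, hj⟩
  | cons ξ w ih =>
    obtain ⟨k, hk⟩ := ih
    obtain ⟨j, hj⟩ := exists_carryStep_to hd hk.lt.1 ξ
    exact ⟨j, k, hj, hk⟩

lemma exists_carryReach_from (hd : IsDigitSystem d M) (w : List (Fin 2)) {j : ℕ} (hj : j < M) :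
    ∃ j', CarryReach d M w j j' := by
  induction w generalizing j with
  | nil => exact ⟨j, rfl, hj⟩
  | cons ξ w ih =>
    obtain ⟨k, hk⟩ := exists_carryStep_from hd hj ξ
    obtain ⟨j', hj'⟩ := ih hk.2.1
    exact ⟨j', k, hk, hj'⟩

lemma exists_carryReach_from_zero (hd : IsDigitSystem d M) (j : ℕ) (hj : j < M) :
    ∃ w, CarryReach d M w 0 j := by
  induction j using Nat.strong_induction_on with
  | _ j ih =>
    rcases Nat.eq_zero_or_pos j with rfl | h
    · exact ⟨[], rfl, hj⟩
    · obtain ⟨w, hw⟩ := ih (j / 2) (by omega) (by omega)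
      exact ⟨w ++ [_], hw.append ⟨j, carryStep_of_add_eq (y := j) (by omega) hj 0
        (by simp [hd.zero]), rfl, hj⟩⟩

lemma exists_carryReach_div_zero (hd : IsDigitSystem d M) (n t : ℕ) (ht : t < 2 ^ n) :
    ∃ w, CarryReach d M w (M * t / 2 ^ n) 0 := by
  induction n generalizing t with
  | zero => exact ⟨[], by simp at ht; simp [ht], by simp at ht; simp [ht, hd.pos]⟩
  | succ n ih =>
    obtain ⟨s, i, hs, h⟩ :
        ∃ s, ∃ i : Fin 3, s < 2 ^ n ∧ M * t / 2 ^ n = M * s / 2 ^ n + d i := by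
      by_cases h : t < 2 ^ n
      · exact ⟨t, 0, h, by simp [hd.zero]⟩
      · obtain ⟨i, hi⟩ := hd.top
        refine ⟨t - 2 ^ n, i, by rw [pow_succ] at ht; omega, ?_⟩
        rw [hi, ← Nat.add_mul_div_right _ _ (by positivity), ← mul_add,
          Nat.sub_add_cancel (by omega)]
    obtain ⟨w, hw⟩ := ih s hs
    have hlt := hw.lt.1
    have hstep := carryStep_of_add_eq (by have := hd.le i; omega) hlt i h
    rw [Nat.div_div_eq_div_mul, ← pow_succ] at hstep
    exact ⟨_ :: w, M * s / 2 ^ n, hstep, hw⟩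

lemma exists_carryReach_zero (hd : IsDigitSystem d M) {j : ℕ} (hj : j < M) :
    ∃ w, CarryReach d M w j 0 := by
  have hM : M < 2 ^ M := Nat.lt_two_pow_self
  have h1 := Nat.div_mul_le_self (j * 2 ^ M + (M - 1)) M
  have h2 := Nat.lt_div_mul_add (a := j * 2 ^ M + (M - 1)) hd.pos
  have h3 : (j + 1) * 2 ^ M ≤ M * 2 ^ M := Nat.mul_le_mul_right _ hj
  set t := (j * 2 ^ M + (M - 1)) / M with ht
  have ht2 : t < 2 ^ M := by
    by_contra! hcon
    have : 2 ^ M * M ≤ t * M := Nat.mul_le_mul_right _ hcon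
    rw [add_mul, mul_comm M] at h3
    omega
  have hjt : M * t / 2 ^ M = j := by
    rw [mul_comm]
    refine Nat.div_eq_of_lt_le ?_ ?_
    · omega
    · rw [add_mul]; omega
  obtain ⟨w, hw⟩ := exists_carryReach_div_zero hd M t ht2
  exact ⟨w, hjt ▸ hw⟩

lemma exists_carryReach (hd : IsDigitSystem d M) {j j' : ℕ} (hj : j < M) (hj' : j' < M) :
    ∃ w, CarryReach d M w j j' := by
  obtain ⟨w, hw⟩ := exists_carryReach_zero hd hj
  obtain ⟨v, hv⟩ := exists_carryReach_from_zero hd j' hj'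
  exact ⟨w ++ v, hw.append hv⟩

lemma exists_common_carryStep (hd : IsDigitSystem d M) {i : Fin 3} {z : ℕ} (hz : z < M) :
    ∃ ξ k, CarryStep d M ξ k z ∧ CarryStep d M ξ k ((z + d i) % M) := by
  have hi := hd.le i
  refine ⟨_, _, carryStep_of_add_eq (y := z + d i) (by omega) hz i rfl, ?_⟩
  by_cases h : z + d i < M
  · exact carryStep_of_add_eq (by omega) (Nat.mod_lt _ hd.pos) 0
      (by rw [hd.zero, Nat.mod_eq_of_lt h, add_zero])
  · obtain ⟨l, hl⟩ := hd.top
    refine carryStep_of_add_eq (by omega) (Nat.mod_lt _ hd.pos) l ?_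
    rw [hl, Nat.mod_eq_sub_mod (by omega), Nat.mod_eq_of_lt (by omega)]
    omega

/-- The set of states that can be reached from `j` by reading `w`. -/
def carryReachSet (d : Fin 3 → ℕ) (M : ℕ) (w : List (Fin 2)) (j : ℕ) : Finset ℕ :=
  (Finset.range M).filter (CarryReach d M w j)

lemma mem_carryReachSet {w : List (Fin 2)} {j j' : ℕ} :
    j' ∈ carryReachSet d M w j ↔ CarryReach d M w j j' := by
  simp only [carryReachSet, Finset.mem_filter, Finset.mem_range, and_iff_right_iff_imp]
  exact fun h => h.lt.2

lemma exists_max_carryReachSet (hd : IsDigitSystem d M) :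
    ∃ w j, j < M ∧ ∀ w' j', (carryReachSet d M w' j').card ≤ (carryReachSet d M w j).card := by
  have hbdd : BddAbove {n | ∃ w j, (carryReachSet d M w j).card = n} := by
    refine ⟨M, ?_⟩
    rintro _ ⟨w, j, rfl⟩
    exact (Finset.card_filter_le _ _).trans (by simp)
  obtain ⟨w, j, h⟩ := Nat.sSup_mem (s := {n | ∃ w j, (carryReachSet d M w j).card = n})
    ⟨_, [], 0, rfl⟩ hbdd
  have hmax : ∀ w' j', (carryReachSet d M w' j').card ≤ (carryReachSet d M w j).card :=
    fun w' j' => h ▸ le_csSup hbdd ⟨w', j', rfl⟩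
  refine ⟨w, j, ?_, hmax⟩
  have h1 := hmax [] 0
  have h2 : (0 : ℕ) ∈ carryReachSet d M [] 0 := mem_carryReachSet.mpr ⟨rfl, hd.pos⟩
  obtain ⟨x, hx⟩ := Finset.card_pos.mp ((Finset.card_pos.mpr ⟨_, h2⟩).trans_le h1)
  exact (mem_carryReachSet.mp hx).lt.1

lemma exists_add_mul_mod_eq {b z j : ℕ} (hM : 0 < M) (hb : Nat.Coprime b M) (hz : z < M) :
    ∃ m, (j + m * b) % M = z := by
  obtain ⟨u, hu⟩ := Int.mod_coprime hb
  have hM' : (0 : ℤ) < M := by exact_mod_cast hM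
  refine ⟨(((z - j) * u) % M).toNat, ?_⟩
  zify
  rw [Int.toNat_of_nonneg (Int.emod_nonneg _ hM'.ne')]
  have : (j + ((z - j) * u % M) * b : ℤ) ≡ z [ZMOD M] := by
    calc (j + ((z - j) * u % M) * b : ℤ) ≡ j + ((z - j) * u) * b [ZMOD M] :=
          Int.ModEq.add_left _ (Int.ModEq.mul_right _ (Int.mod_modEq _ _))
      _ = j + (z - j) * (b * u) := by ring
      _ ≡ j + (z - j) * 1 [ZMOD M] := Int.ModEq.add_left _ (Int.ModEq.mul_left _ hu)
      _ = z := by ring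
  rw [this.eq]
  exact Int.emod_eq_of_lt (by positivity) (by exact_mod_cast hz)

/-- Some word moves every state of the carry automaton to every state. -/
lemma exists_positive_word (hd : IsDigitSystem d M) :
    ∃ w, ∀ j j', j < M → j' < M → CarryReach d M w j j' := by
  obtain ⟨w₀, j₀, hj₀, hmax⟩ := exists_max_carryReachSet hd
  set U := carryReachSet d M w₀ j₀ with hU
  obtain ⟨i, hi⟩ := hd.coprime
  have hext : ∀ m, ∃ w, ∀ l ≤ m, carryReachSet d M w ((j₀ + l * d i) % M) = U := by
    intro m
    induction m with
    | zero => exact ⟨w₀, fun l hl => by simp [Nat.le_zero.mp hl, Nat.mod_eq_of_lt hj₀, hU]⟩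
    | succ m ih =>
      obtain ⟨w, hw⟩ := ih
      set z := (j₀ + (m + 1) * d i) % M with hz
      have hzM : z < M := Nat.mod_lt _ hd.pos
      obtain ⟨ξ, k, hk1, hk2⟩ := exists_common_carryStep hd (i := i)
        (z := (j₀ + m * d i) % M) (Nat.mod_lt _ hd.pos)
      rw [Nat.mod_add_mod, add_assoc, ← Nat.succ_mul] at hk2
      have hsub1 : U ⊆ carryReachSet d M (ξ :: w) k := fun x hx => by
        rw [← hw m le_rfl] at hx
        exact mem_carryReachSet.mpr ⟨_, hk1, mem_carryReachSet.mp hx⟩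
      have hsub2 : carryReachSet d M w z ⊆ carryReachSet d M (ξ :: w) k := fun x hx =>
        mem_carryReachSet.mpr ⟨_, hk2, mem_carryReachSet.mp hx⟩
      rw [← Finset.eq_of_subset_of_card_le hsub1 (hmax _ _)] at hsub2
      obtain ⟨x, hx⟩ := exists_carryReach_from hd w hzM
      have hxU : x ∈ U := hsub2 (mem_carryReachSet.mpr hx)
      obtain ⟨v, hv⟩ := exists_carryReach hd hx.lt.2 hj₀
      have key : ∀ y, CarryReach d M w y x → carryReachSet d M (w ++ (v ++ w₀)) y = U := by
        intro y hy
        refine (Finset.eq_of_subset_of_card_le (fun u hu => ?_) (hmax _ _)).symm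
        exact mem_carryReachSet.mpr (hy.append (hv.append (mem_carryReachSet.mp hu)))
      refine ⟨w ++ (v ++ w₀), fun l hl => ?_⟩
      rcases Nat.le_succ_iff.mp hl with hl | rfl
      · exact key _ (mem_carryReachSet.mp (by rw [hw l hl]; exact hxU))
      · exact key _ hx
  have hall : ∃ m, ∀ z < M, ∃ l ≤ m, (j₀ + l * d i) % M = z := by
    choose! l hl using fun z (hz : z < M) => exists_add_mul_mod_eq (j := j₀) hd.pos hi hz
    exact ⟨(Finset.range M).sup l, fun z hz =>
      ⟨l z, Finset.le_sup (Finset.mem_range.mpr hz), hl z hz⟩⟩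
  obtain ⟨m, hm⟩ := hall
  obtain ⟨w, hw⟩ := hext m
  have hw' : ∀ z < M, carryReachSet d M w z = U := fun z hz => by
    obtain ⟨l, hl, rfl⟩ := hm z hz
    exact hw l hl
  refine ⟨w, fun j j' hj hj' => ?_⟩
  obtain ⟨k, hk⟩ := exists_carryReach_to hd w hj'
  rw [← mem_carryReachSet, hw' j hj, ← hw' k hk.lt.1]
  exact mem_carryReachSet.mpr hk

/-- The number whose binary expansion starts with `w` and continues with that of `x`. -/
def prependWord : List (Fin 2) → ℝ → ℝ
  | [], x => x
  | ξ :: w, x => ((ξ : ℕ) + prependWord w x) / 2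

lemma le_transferOp_of_carryReach {w : List (Fin 2)} {j j' : ℕ} (h : CarryReach d M w j j')
    {F : ℝ → ℝ} (hF : ∀ z, 0 ≤ F z) (x : ℝ) :
    F (j' + x) ≤ transferOp d w.length F (j + prependWord w x) := by
  induction w generalizing j with
  | nil => obtain ⟨rfl, -⟩ := h; exact le_rfl
  | cons ξ w ih =>
    obtain ⟨k, ⟨-, -, i, hi⟩, h2⟩ := h
    have hi' : 2 * (j : ℝ) + (ξ : ℕ) = k + d i := by exact_mod_cast hi
    refine (ih h2).trans ?_
    simp only [List.length_cons, transferOp, prependWord]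
    have e : (k : ℝ) + prependWord w x
        = 2 * (j + ((ξ : ℕ) + prependWord w x) / 2) - d i := by linarith
    rw [e]
    exact Finset.single_le_sum (f := fun i => transferOp d w.length F
      (2 * (j + ((ξ : ℕ) + prependWord w x) / 2) - d i))
      (fun i _ => transferOp_nonneg _ hF _) (Finset.mem_univ i)

lemma exists_prependWord_eq (w : List (Fin 2)) :
    ∃ u : ℕ, u < 2 ^ w.length ∧ ∀ x, prependWord w x = (u + x) / 2 ^ w.length := by
  induction w with
  | nil => exact ⟨0, by simp, fun x => by simp [prependWord]⟩
  | cons ξ w ih =>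
    obtain ⟨u, hu, h⟩ := ih
    refine ⟨ξ * 2 ^ w.length + u, ?_, fun x => ?_⟩
    · have : (ξ : ℕ) * 2 ^ w.length ≤ 1 * 2 ^ w.length := Nat.mul_le_mul_right _ (by omega)
      rw [List.length_cons, pow_succ]
      omega
    · rw [prependWord, h, List.length_cons, pow_succ]
      push_cast
      field_simp
      ring

/-- There is a dyadic interval on which all the counts are comparable. -/
lemma exists_synchronizing_interval (hd : IsDigitSystem d M) :
    ∃ l u : ℕ, u < 2 ^ l ∧ ∀ y : ℝ, ⌊2 ^ l * Int.fract y⌋ = u → ∀ n,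
      fiberSum d M n (2 ^ l * y) ≤ M * fiberMin d M (l + n) y := by
  obtain ⟨w, hw⟩ := exists_positive_word hd
  obtain ⟨u, hu, hwu⟩ := exists_prependWord_eq w
  refine ⟨w.length, u, hu, fun y hy n => ?_⟩
  have : Nonempty (Fin M) := ⟨⟨0, hd.pos⟩⟩
  have hfr : Int.fract (2 ^ w.length * y) = 2 ^ w.length * Int.fract y - u := by
    have e : 2 ^ w.length * y = 2 ^ w.length * Int.fract y + ((2 ^ w.length * ⌊y⌋ : ℤ) : ℝ) := by
      have := Int.floor_add_fract y
      push_cast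
      linear_combination (-(2 ^ w.length : ℝ)) * this
    rw [e, Int.fract_add_intCast, Int.fract, hy]
    simp
  have key : ∀ j < M, ∀ j' < M, cylCount d M n (j' + Int.fract (2 ^ w.length * y))
      ≤ cylCount d M (w.length + n) (j + Int.fract y) := fun j hj j' hj' => by
    have := le_transferOp_of_carryReach (hw j j' hj hj') (cylCount_nonneg (d := d) (M := M) n)
      (Int.fract (2 ^ w.length * y))
    rw [cylCount_add]
    convert this using 2
    rw [hwu, hfr]
    field_simp
    ring
  have hmin : ∀ j' < M, cylCount d M n (j' + Int.fract (2 ^ w.length * y))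
      ≤ fiberMin d M (w.length + n) y := fun j' hj' => le_ciInf fun j => key j j.2 j' hj'
  calc fiberSum d M n (2 ^ w.length * y)
      ≤ ∑ _j ∈ Finset.range M, fiberMin d M (w.length + n) y :=
        Finset.sum_le_sum fun j hj => hmin j (Finset.mem_range.mp hj)
    _ = M * fiberMin d M (w.length + n) y := by simp

/-- Visiting the synchronizing interval at time `k * l` bounds the distortion. -/
lemma fiberSum_le_of_visit (hd : IsDigitSystem d M) {l u : ℕ}
    (hu : ∀ y : ℝ, ⌊2 ^ l * Int.fract y⌋ = u → ∀ n,
      fiberSum d M n (2 ^ l * y) ≤ M * fiberMin d M (l + n) y)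
    (k : ℕ) (y : ℝ) (hy : ⌊2 ^ l * Int.fract (2 ^ (k * l) * y)⌋ = u) (n : ℕ) :
    fiberSum d M n y ≤ (M * (M * 3 ^ l)) ^ (k + 1) * fiberMin d M n y := by
  have hM : (1 : ℝ) ≤ M := by exact_mod_cast hd.pos
  have h3 : (1 : ℝ) ≤ 3 ^ l := one_le_pow₀ (by norm_num)
  have hA : (M * 3 ^ l : ℝ) ≤ M * (M * 3 ^ l) := le_mul_of_one_le_left (by positivity) hM
  have hC : (1 : ℝ) ≤ M * (M * 3 ^ l) := le_trans (by nlinarith) hA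
  have hsplit : ∀ m y, fiberSum d M (l + m) y ≤ M * 3 ^ l * fiberSum d M m (2 ^ l * y) :=
    fun m y => (fiberSum_add_le hd l m y).trans (mul_le_mul_of_nonneg_right (fiberSum_le l y)
      (zero_le_one.trans (one_le_fiberSum hd _ _)))
  induction k generalizing y n with
  | zero =>
    rw [zero_add, pow_one]
    rcases lt_or_ge n l with hn | hn
    · calc fiberSum d M n y ≤ M * 3 ^ n := fiberSum_le n y
        _ ≤ M * 3 ^ l := by gcongr; norm_num
        _ ≤ M * (M * 3 ^ l) := hA
        _ ≤ _ := le_mul_of_one_le_right (by positivity) (one_le_fiberMin hd n y)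
    obtain ⟨m, rfl⟩ := Nat.exists_eq_add_of_le hn
    have := hu y (by simpa using hy) m
    calc fiberSum d M (l + m) y ≤ M * 3 ^ l * fiberSum d M m (2 ^ l * y) := hsplit m y
      _ ≤ M * 3 ^ l * (M * fiberMin d M (l + m) y) := by gcongr
      _ = _ := by ring
  | succ k ih =>
    rcases lt_or_ge n l with hn | hn
    · calc fiberSum d M n y ≤ M * 3 ^ n := fiberSum_le n y
        _ ≤ M * 3 ^ l := by gcongr; norm_num
        _ ≤ M * (M * 3 ^ l) := hA
        _ ≤ (M * (M * 3 ^ l)) ^ (k + 1 + 1) := le_self_pow₀ hC (by omega)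
        _ ≤ _ := le_mul_of_one_le_right (by positivity) (one_le_fiberMin hd n y)
    obtain ⟨m, rfl⟩ := Nat.exists_eq_add_of_le hn
    have h1 := ih (2 ^ l * y) (by rw [← mul_assoc, ← pow_add, ← Nat.succ_mul]; exact hy) m
    have h2 : fiberMin d M m (2 ^ l * y) ≤ fiberMin d M (l + m) y :=
      (le_mul_of_one_le_left (zero_le_one.trans (one_le_fiberMin hd m _))
        (one_le_fiberMin hd l y)).trans (le_fiberMin_add hd l m y)
    calc fiberSum d M (l + m) y ≤ M * 3 ^ l * fiberSum d M m (2 ^ l * y) := hsplit m y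
      _ ≤ M * (M * 3 ^ l) * ((M * (M * 3 ^ l)) ^ (k + 1) * fiberMin d M (l + m) y) := by
        exact mul_le_mul hA (h1.trans (by gcongr)) (zero_le_one.trans (one_le_fiberSum hd m _))
          (by positivity)
      _ = _ := by ring

end Automaton

section Strictness

open Polynomial

variable {d : Fin 3 → ℕ} {M : ℕ}

/-- The generating polynomial of the digit sums `∑ k < n, 2 ^ k * d (w k)`. -/
def digitPoly (d : Fin 3 → ℕ) (n : ℕ) : ℝ[X] := ∏ k ∈ Finset.range n, ∑ i, X ^ (d i * 2 ^ k)

/-- The polynomial with coefficients `u`. -/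
def vecPoly (u : Fin M → ℝ) : ℝ[X] := ∑ j : Fin M, C (u j) * X ^ (j : ℕ)

/-- The sum of the coefficients of `vecPoly u * digitPoly d n` in the residue class of `t`. -/
def residueSum (d : Fin 3 → ℕ) (n : ℕ) (u : Fin M → ℝ) (t : ℕ) : ℝ :=
  ∑ j ∈ Finset.range M, (vecPoly u * digitPoly d n).coeff (2 ^ n * j + t)

lemma coeff_vecPoly (u : Fin M → ℝ) (m : ℕ) :
    (vecPoly u).coeff m = if h : m < M then u ⟨m, h⟩ else 0 := by
  simp only [vecPoly, finsetSum_coeff, coeff_C_mul_X_pow]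
  split_ifs with h
  · rw [Finset.sum_eq_single ⟨m, h⟩]
    · simp
    · intro j _ hj
      rw [if_neg]
      rintro rfl
      exact hj rfl
    · simp
  · refine Finset.sum_eq_zero fun j _ => if_neg ?_
    have := j.2
    omega

lemma coeff_mul_digitPoly_succ (P : ℝ[X]) (n m : ℕ) :
    (P * digitPoly d (n + 1)).coeff m =
      ∑ i, if d i * 2 ^ n ≤ m then (P * digitPoly d n).coeff (m - d i * 2 ^ n) else 0 := by
  rw [digitPoly, Finset.prod_range_succ, ← mul_assoc, Finset.mul_sum, finsetSum_coeff]
  simp only [coeff_mul_X_pow', digitPoly]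

lemma coeff_vecPoly_mul_digitPoly_nonneg {u : Fin M → ℝ} (hu : ∀ j, 0 ≤ u j) (n m : ℕ) :
    0 ≤ (vecPoly u * digitPoly d n).coeff m := by
  induction n generalizing m with
  | zero =>
    rw [digitPoly, Finset.prod_range_zero, mul_one, coeff_vecPoly]
    split_ifs
    exacts [hu _, le_rfl]
  | succ n ih =>
    rw [coeff_mul_digitPoly_succ]
    refine Finset.sum_nonneg fun i _ => ?_
    split_ifs
    exacts [ih _, le_rfl]

lemma cylCount_eq_coeff (hd : IsDigitSystem d M) (n m Y : ℕ) {x : ℝ} (h0 : 0 ≤ x) (h1 : x < 1) :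
    cylCount d M (n + m) ((Y + x) / 2 ^ n) =
      (vecPoly (fun j : Fin M => cylCount d M m ((j : ℕ) + x)) * digitPoly d n).coeff Y := by
  induction n generalizing Y with
  | zero =>
    rw [digitPoly, Finset.prod_range_zero, mul_one, coeff_vecPoly]
    split_ifs with h
    · simp
    · rw [zero_add, pow_zero, div_one]
      refine cylCount_eq_zero hd m fun hY => h ?_
      have : (Y : ℝ) < M := by linarith
      exact_mod_cast this
  | succ n ih =>
    rw [coeff_mul_digitPoly_succ, Nat.succ_add, cylCount_succ]
    refine Finset.sum_congr rfl fun i _ => ?_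
    split_ifs with h
    · rw [← ih]
      congr 1
      push_cast [Nat.cast_sub h]
      field_simp
      ring
    · refine cylCount_eq_zero hd _ fun hY => h ?_
      have h2 := hY.1
      rw [sub_nonneg, pow_succ] at h2
      field_simp at h2
      have : ((d i * 2 ^ n : ℕ) : ℝ) < (Y + 1 : ℕ) := by push_cast; linarith
      exact Nat.lt_succ_iff.mp (by exact_mod_cast this)

lemma fiberSum_eq_residueSum (hd : IsDigitSystem d M) (n m : ℕ) {t : ℕ} (ht : t < 2 ^ n) {x : ℝ}
    (h0 : 0 ≤ x) (h1 : x < 1) :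
    fiberSum d M (n + m) ((t + x) / 2 ^ n) =
      residueSum d n (fun j : Fin M => cylCount d M m ((j : ℕ) + x)) t := by
  have h2 : (t : ℝ) + 1 ≤ 2 ^ n := by exact_mod_cast ht
  have hfr : Int.fract ((t + x) / 2 ^ n) = (t + x) / 2 ^ n :=
    Int.fract_eq_self.mpr ⟨by positivity, by rw [div_lt_one (by positivity)]; linarith⟩
  refine Finset.sum_congr rfl fun j _ => ?_
  rw [← cylCount_eq_coeff hd n m _ h0 h1, hfr]
  congr 1
  push_cast
  field_simp
  ring

lemma natDegree_digitPoly_le (hd : ∀ i, d i ≤ M) (n : ℕ) :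
    (digitPoly d n).natDegree ≤ M * (2 ^ n - 1) := by
  induction n with
  | zero => simp [digitPoly]
  | succ n ih =>
    rw [digitPoly, Finset.prod_range_succ]
    refine natDegree_mul_le.trans ?_
    have h1 : (∑ i, (X : ℝ[X]) ^ (d i * 2 ^ n)).natDegree ≤ M * 2 ^ n :=
      natDegree_sum_le_of_forall_le _ _ fun i _ =>
        (natDegree_X_pow_le _).trans (Nat.mul_le_mul_right _ (hd i))
    refine (Nat.add_le_add ih h1).trans (le_of_eq ?_)
    rw [← mul_add]
    congr 1
    have := Nat.one_le_two_pow (n := n)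
    rw [pow_succ]
    omega

lemma natDegree_vecPoly_lt (hM : 0 < M) (u : Fin M → ℝ) : (vecPoly u).natDegree < M := by
  refine lt_of_le_of_lt (natDegree_sum_le_of_forall_le (n := M - 1) _ _ fun j _ => ?_) (by omega)
  exact (natDegree_C_mul_X_pow_le _ _).trans (by have := j.2; omega)

lemma aeval_vecPoly_mul_digitPoly (hd : IsDigitSystem d M) (u : Fin M → ℝ) (n : ℕ) {ζ : ℂ}
    (hζ : ζ ^ 2 ^ n = 1) :
    aeval ζ (vecPoly u * digitPoly d n) =
      ∑ t ∈ Finset.range (2 ^ n), (residueSum d n u t : ℂ) * ζ ^ t := by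
  have hdeg : (vecPoly u * digitPoly d n).natDegree < 2 ^ n * M := by
    refine lt_of_le_of_lt natDegree_mul_le ?_
    have h1 := natDegree_vecPoly_lt hd.pos u
    have h2 := natDegree_digitPoly_le hd.le n
    have h3 : M * (2 ^ n - 1) + M = 2 ^ n * M := by
      have := Nat.one_le_two_pow (n := n)
      rw [← Nat.mul_succ, Nat.succ_eq_add_one, Nat.sub_add_cancel this, mul_comm]
    omega
  have key : ∀ (g : ℕ → ℂ) (L : ℕ), ∑ m ∈ Finset.range (2 ^ n * L), g m =
      ∑ t ∈ Finset.range (2 ^ n), ∑ j ∈ Finset.range L, g (2 ^ n * j + t) := by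
    intro g L
    induction L with
    | zero => simp
    | succ L ih =>
      simp only [Finset.sum_range_succ, Finset.sum_add_distrib]
      rw [Nat.mul_succ, Finset.sum_range_add, ih]
  rw [aeval_eq_sum_range' hdeg, key]
  refine Finset.sum_congr rfl fun t _ => ?_
  rw [residueSum, Complex.ofReal_sum, Finset.sum_mul]
  refine Finset.sum_congr rfl fun j _ => ?_
  rw [pow_add, pow_mul, hζ, one_pow, one_mul, Complex.real_smul]

lemma sum_residueSum (hd : IsDigitSystem d M) (u : Fin M → ℝ) (n : ℕ) :
    ∑ t ∈ Finset.range (2 ^ n), residueSum d n u t = 3 ^ n * ∑ j, u j := by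
  have h := aeval_vecPoly_mul_digitPoly hd u n (one_pow _)
  simp only [one_pow, mul_one, map_mul, vecPoly, digitPoly, map_sum, map_prod, map_pow, aeval_X,
    aeval_C, Finset.sum_const, Finset.prod_const, Finset.card_range, Finset.card_univ,
    Fintype.card_fin] at h
  have h2 : ((∑ t ∈ Finset.range (2 ^ n), residueSum d n u t : ℝ) : ℂ)
      = ((3 ^ n * ∑ j, u j : ℝ) : ℂ) := by
    push_cast
    rw [← h, mul_comm]
    simp
  exact_mod_cast h2

lemma one_add_add_ne_zero {α β : ℂ} {n : ℕ} (hα : α ^ 2 ^ n = 1) (hβ : β ^ 2 ^ n = 1) :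
    1 + α + β ≠ 0 := by
  intro h
  have hn : (2 : ℕ) ^ n ≠ 0 := by positivity
  have hα0 : α ≠ 0 := by rintro rfl; simp at hα
  have hβ0 : β ≠ 0 := by rintro rfl; simp at hβ
  have cα : (starRingEnd ℂ) α = α⁻¹ :=
    (Complex.inv_eq_conj (Complex.norm_eq_one_of_pow_eq_one hα hn)).symm
  have cβ : (starRingEnd ℂ) β = β⁻¹ :=
    (Complex.inv_eq_conj (Complex.norm_eq_one_of_pow_eq_one hβ hn)).symm
  have h2 := congrArg (starRingEnd ℂ) h
  simp only [map_add, map_one, map_zero, cα, cβ] at h2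
  field_simp at h2
  have h3 : α ^ 3 = 1 := by
    have hb : β = -1 - α := by linear_combination h
    rw [hb] at h2
    linear_combination (1 - α) * h2
  have h4 : orderOf α ∣ 1 := by
    have := Nat.dvd_gcd (orderOf_dvd_of_pow_eq_one hα) (orderOf_dvd_of_pow_eq_one h3)
    rwa [Nat.Coprime.pow_left n (by norm_num : Nat.Coprime 2 3)] at this
  have h5 : α = 1 := orderOf_eq_one_iff.mp (Nat.dvd_one.mp h4)
  subst h5
  have hb : β = -2 := by linear_combination h
  have := Complex.norm_eq_one_of_pow_eq_one hβ hn
  rw [hb] at this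
  norm_num at this

/-- The residue sums of a nonzero vector are not all equal once `M < 2 ^ n`. -/
lemma exists_residueSum_ne (hd : IsDigitSystem d M) {n : ℕ} (hn : M < 2 ^ n) {u : Fin M → ℝ}
    (hu : u ≠ 0) (c : ℝ) : ∃ t < 2 ^ n, residueSum d n u t ≠ c := by
  by_contra! hcon
  have hn0 : (2 : ℕ) ^ n ≠ 0 := by positivity
  have hprim := Complex.isPrimitiveRoot_exp (2 ^ n) hn0
  set ζ := Complex.exp (2 * Real.pi * Complex.I / (2 ^ n : ℕ)) with hζdef
  have hroot : ∀ k ∈ Finset.Ico 1 (2 ^ n), (vecPoly u).aeval (ζ ^ k) = 0 := by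
    intro k hk
    rw [Finset.mem_Ico] at hk
    have hζ1 : (ζ ^ k) ^ 2 ^ n = 1 := by
      rw [← pow_mul, mul_comm, pow_mul, hprim.pow_eq_one, one_pow]
    have hne : ζ ^ k ≠ 1 := hprim.pow_ne_one_of_pos_of_lt (by omega) hk.2
    have h := aeval_vecPoly_mul_digitPoly hd u n hζ1
    have h0 : ∑ t ∈ Finset.range (2 ^ n), (residueSum d n u t : ℂ) * (ζ ^ k) ^ t = 0 := by
      rw [Finset.sum_congr rfl fun t ht => by rw [hcon t (Finset.mem_range.mp ht)],
        ← Finset.mul_sum, geom_sum_eq hne, hζ1, sub_self, zero_div, mul_zero]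
    rw [h0, map_mul] at h
    refine (mul_eq_zero.mp h).resolve_right ?_
    rw [digitPoly, map_prod]
    refine Finset.prod_ne_zero_iff.mpr fun j _ => ?_
    rw [map_sum, Fin.sum_univ_three, hd.zero]
    simp only [map_pow, aeval_X, zero_mul, pow_zero, map_one]
    refine one_add_add_ne_zero (n := n) ?_ ?_ <;>
    · rw [← pow_mul, mul_comm, pow_mul, hζ1, one_pow]
  have hzero : (vecPoly u).map (algebraMap ℝ ℂ) = 0 := by
    refine eq_zero_of_natDegree_lt_card_of_eval_eq_zero' _
      ((Finset.Ico 1 (2 ^ n)).image fun k => ζ ^ k) ?_ ?_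
    · intro z hz
      obtain ⟨k, hk, rfl⟩ := Finset.mem_image.mp hz
      rw [eval_map_algebraMap]
      exact hroot k hk
    · rw [Finset.card_image_of_injOn, Nat.card_Ico]
      · refine lt_of_le_of_lt natDegree_map_le ?_
        have := natDegree_vecPoly_lt hd.pos u
        omega
      · intro a ha b hb hab
        simp only [Finset.coe_Ico, Set.mem_Ico] at ha hb
        exact hprim.pow_inj ha.2 hb.2 hab
  rw [Polynomial.map_eq_zero] at hzero
  refine hu (funext fun j => ?_)
  have := coeff_vecPoly u j
  rw [hzero] at this
  simpa using this.symm

lemma residueSum_nonneg {u : Fin M → ℝ} (hu : ∀ j, 0 ≤ u j) (n t : ℕ) :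
    0 ≤ residueSum d n u t :=
  Finset.sum_nonneg fun _ _ => coeff_vecPoly_mul_digitPoly_nonneg hu n _

lemma residueSum_smul (n : ℕ) (c : ℝ) (u : Fin M → ℝ) (t : ℕ) :
    residueSum d n (c • u) t = c * residueSum d n u t := by
  have : vecPoly (c • u) = C c * vecPoly u := by
    simp [vecPoly, Finset.mul_sum, mul_assoc]
  simp only [residueSum, this, mul_assoc, coeff_C_mul, Finset.mul_sum]

lemma continuous_residueSum (n t : ℕ) :
    Continuous fun u : Fin M → ℝ => residueSum d n u t := by
  simp only [residueSum, vecPoly, Finset.sum_mul, finsetSum_coeff, mul_assoc, coeff_C_mul]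
  fun_prop

lemma sum_sqrt_residueSum_lt (hd : IsDigitSystem d M) {n : ℕ} (hn : M < 2 ^ n) {u : Fin M → ℝ}
    (hu : u ∈ stdSimplex ℝ (Fin M)) :
    ∑ t ∈ Finset.range (2 ^ n), √(residueSum d n u t) < 2 ^ n * √((3 / 2) ^ n) := by
  have hu0 : u ≠ 0 := by
    rintro rfl
    have := hu.2
    simp at this
  set s := √((3 / 2 : ℝ) ^ n) with hs
  have hs0 : 0 < s := by positivity
  have hs2 : s ^ 2 = (3 / 2) ^ n := Real.sq_sqrt (by positivity)
  obtain ⟨t, ht, htne⟩ := exists_residueSum_ne hd hn hu0 (s ^ 2)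
  have hpos : 0 < ∑ t ∈ Finset.range (2 ^ n), (√(residueSum d n u t) - s) ^ 2 := by
    refine Finset.sum_pos' (fun _ _ => sq_nonneg _) ⟨t, Finset.mem_range.mpr ht, ?_⟩
    refine sq_pos_of_ne_zero fun h => htne ?_
    rw [← sub_eq_zero.mp h, Real.sq_sqrt (residueSum_nonneg hu.1 n t)]
  have hexp : ∑ t ∈ Finset.range (2 ^ n), (√(residueSum d n u t) - s) ^ 2
      = 3 ^ n - 2 * s * ∑ t ∈ Finset.range (2 ^ n), √(residueSum d n u t) + 2 ^ n * s ^ 2 := by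
    have h1 := sum_residueSum hd u n
    rw [hu.2, mul_one] at h1
    rw [← h1, Finset.mul_sum, ← Finset.sum_sub_distrib]
    have h2 : (2 : ℝ) ^ n * s ^ 2 = ∑ _t ∈ Finset.range (2 ^ n), s ^ 2 := by simp
    rw [h2, ← Finset.sum_add_distrib]
    refine Finset.sum_congr rfl fun t _ => ?_
    have := Real.sq_sqrt (residueSum_nonneg (d := d) hu.1 n t)
    linear_combination this
  have h3 : (3 : ℝ) ^ n = 2 ^ n * s ^ 2 := by
    rw [hs2, ← mul_pow]; norm_num
  rw [hexp, h3] at hpos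
  have : s * ∑ t ∈ Finset.range (2 ^ n), √(residueSum d n u t) < s * (2 ^ n * s) := by nlinarith
  exact lt_of_mul_lt_mul_left this hs0.le

/-- The square roots of the counts contract strictly faster than by Cauchy–Schwarz. -/
lemma exists_sum_sqrt_fiberSum_le (hd : IsDigitSystem d M) :
    ∃ K : ℕ, 0 < K ∧ ∃ c : ℝ, 0 ≤ c ∧ c < √((3 / 2) ^ K) ∧
      ∀ m : ℕ, ∀ x : ℝ, 0 ≤ x → x < 1 →
        ∑ t ∈ Finset.range (2 ^ K), √(fiberSum d M (K + m) ((t + x) / 2 ^ K)) ≤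
          2 ^ K * c * √(fiberSum d M m x) := by
  have hM : Nonempty (Fin M) := ⟨⟨0, hd.pos⟩⟩
  have hK : M < 2 ^ M := Nat.lt_two_pow_self
  refine ⟨M, hd.pos, ?_⟩
  have hcont : Continuous fun u : Fin M → ℝ =>
      ∑ t ∈ Finset.range (2 ^ M), √(residueSum d M u t) :=
    continuous_finsetSum _ fun t _ => (continuous_residueSum M t).sqrt
  obtain ⟨u₀, hu₀, hmax⟩ := (isCompact_stdSimplex ℝ (Fin M)).exists_isMaxOn
    ⟨_, single_mem_stdSimplex ℝ hM.some⟩ hcont.continuousOn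
  refine ⟨(∑ t ∈ Finset.range (2 ^ M), √(residueSum d M u₀ t)) / 2 ^ M, by positivity, ?_, ?_⟩
  · rw [div_lt_iff₀ (by positivity), mul_comm]
    exact sum_sqrt_residueSum_lt hd hK hu₀
  intro m x h0 h1
  rw [mul_div_cancel₀ _ (by positivity)]
  set u : Fin M → ℝ := fun j => cylCount d M m ((j : ℕ) + x) with hu
  have hfr : Int.fract x = x := Int.fract_eq_self.mpr ⟨h0, h1⟩
  have hS : fiberSum d M m x = ∑ j, u j := by
    rw [fiberSum, hfr, Finset.sum_range]
  have hpos : 0 < ∑ j, u j := hS ▸ zero_lt_one.trans_le (one_le_fiberSum hd m x)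
  have hmem : (∑ j, u j)⁻¹ • u ∈ stdSimplex ℝ (Fin M) := by
    refine ⟨fun j => ?_, ?_⟩
    · exact mul_nonneg (inv_nonneg.mpr hpos.le) (cylCount_nonneg m _)
    · simp only [Pi.smul_apply, smul_eq_mul, ← Finset.mul_sum]
      exact inv_mul_cancel₀ hpos.ne'
  calc ∑ t ∈ Finset.range (2 ^ M), √(fiberSum d M (M + m) ((t + x) / 2 ^ M))
      = ∑ t ∈ Finset.range (2 ^ M),
          √(residueSum d M ((∑ j, u j)⁻¹ • u) t) * √(∑ j, u j) := by
        refine Finset.sum_congr rfl fun t ht => ?_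
        rw [fiberSum_eq_residueSum hd M m (Finset.mem_range.mp ht) h0 h1, ← Real.sqrt_mul'
          _ hpos.le, residueSum_smul, mul_comm, mul_inv_cancel_left₀ hpos.ne']
    _ ≤ _ := by
        rw [← Finset.sum_mul, hS]
        exact mul_le_mul_of_nonneg_right (hmax hmem) (Real.sqrt_nonneg _)

end Strictness

/-- Lebesgue measure on `[0, 1)`. -/
def unitMeas : Measure ℝ := volume.restrict (Ico 0 1)

instance : IsProbabilityMeasure unitMeas :=
  ⟨by simp [unitMeas]⟩

section Doubling

lemma volume_inter_Ico_div (n t : ℕ) {E : Set ℝ} (hE : MeasurableSet E) :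
    volume (E ∩ Ico ((t : ℝ) / 2 ^ n) ((t + 1) / 2 ^ n)) =
      ((2 : ℝ≥0∞) ^ n)⁻¹ * unitMeas.map (fun y : ℝ => (t + y) / 2 ^ n) E := by
  have hf : Measurable fun y : ℝ => (t + y) / 2 ^ n := by fun_prop
  have h2 : (0 : ℝ) < 2 ^ n := by positivity
  rw [Measure.map_apply hf hE, unitMeas, Measure.restrict_apply (hf hE)]
  have e : (fun y : ℝ => (t + y) / 2 ^ n) ⁻¹' E ∩ Ico 0 1 =
      (fun y : ℝ => t + y) ⁻¹' ((fun y : ℝ => y * (2 ^ n)⁻¹) ⁻¹'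
        (E ∩ Ico ((t : ℝ) / 2 ^ n) ((t + 1) / 2 ^ n))) := by
    ext y
    simp only [mem_inter_iff, mem_preimage, mem_Ico, ← div_eq_mul_inv,
      div_le_div_iff_of_pos_right h2, div_lt_div_iff_of_pos_right h2]
    constructor
    · rintro ⟨h, h0, h1⟩; exact ⟨h, by linarith, by linarith⟩
    · rintro ⟨h, h0, h1⟩; exact ⟨h, by linarith, by linarith⟩
  rw [e, measure_preimage_add, Real.volume_preimage_mul_right (by positivity), inv_inv,
    abs_of_pos h2, ENNReal.ofReal_pow (by norm_num), ENNReal.ofReal_ofNat, ← mul_assoc,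
    ENNReal.inv_mul_cancel (by simp) (by simp), one_mul]

lemma unitMeas_eq_sum_map (n : ℕ) :
    unitMeas = ((2 : ℝ≥0∞) ^ n)⁻¹ •
      ∑ t ∈ Finset.range (2 ^ n), unitMeas.map fun y : ℝ => (t + y) / 2 ^ n := by
  have h2 : (0 : ℝ) < 2 ^ n := by positivity
  ext E hE
  rw [Measure.smul_apply, Measure.finsetSum_apply, smul_eq_mul, Finset.mul_sum,
    ← Finset.sum_congr rfl fun t _ => volume_inter_Ico_div n t hE, unitMeas,
    Measure.restrict_apply hE, ← measure_biUnion_finset]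
  · congr 1
    ext y
    simp only [mem_inter_iff, mem_iUnion, Finset.mem_range, mem_Ico, exists_prop]
    constructor
    · rintro ⟨hy, h0, h1⟩
      refine ⟨⌊2 ^ n * y⌋₊, ?_, hy, ?_, ?_⟩
      · rw [Nat.floor_lt (by positivity)]
        push_cast
        nlinarith
      · rw [div_le_iff₀ h2, mul_comm y]
        exact Nat.floor_le (by positivity)
      · rw [lt_div_iff₀ h2, mul_comm y]
        exact Nat.lt_floor_add_one _
    · rintro ⟨t, ht, hy, h0, h1⟩
      refine ⟨hy, le_trans (by positivity) h0, h1.trans_le ?_⟩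
      rw [div_le_one h2]
      exact_mod_cast ht
  · intro s _ t _ hst
    refine Set.disjoint_left.mpr fun y hs ht => hst ?_
    have hs1 := hs.2.1
    have hs2 := hs.2.2
    have ht1 := ht.2.1
    have ht2 := ht.2.2
    have h1 := hs1.trans_lt ht2
    have h3 := ht1.trans_lt hs2
    rw [div_lt_div_iff_of_pos_right h2] at h1 h3
    have h1' : s < t + 1 := by exact_mod_cast h1
    have h3' : t < s + 1 := by exact_mod_cast h3
    omega
  · exact fun t _ => hE.inter measurableSet_Ico

lemma integral_unitMeas_eq (n : ℕ) {F : ℝ → ℝ} (hF : Measurable F) (C : ℝ)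
    (hC : ∀ x, ‖F x‖ ≤ C) :
    ∫ x, F x ∂unitMeas =
      (2 ^ n)⁻¹ * ∫ x, ∑ t ∈ Finset.range (2 ^ n), F ((t + x) / 2 ^ n) ∂unitMeas := by
  conv_lhs => rw [unitMeas_eq_sum_map n]
  rw [integral_smul_measure, integral_finsetSum_measure, integral_finsetSum]
  · simp only [ENNReal.toReal_inv, ENNReal.toReal_pow, ENNReal.toReal_ofNat, smul_eq_mul]
    congr 1
    refine Finset.sum_congr rfl fun t _ => ?_
    exact integral_map (by fun_prop) hF.aestronglyMeasurable
  · exact fun t _ => Integrable.of_bound (hF.comp (by fun_prop)).aestronglyMeasurable C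
      (ae_of_all _ fun x => hC _)
  · intro t _
    have : IsProbabilityMeasure (unitMeas.map fun y : ℝ => (t + y) / 2 ^ n) :=
      Measure.isProbabilityMeasure_map (by fun_prop)
    exact Integrable.of_bound hF.aestronglyMeasurable C (ae_of_all _ hC)

lemma ae_unitMeas_mem : ∀ᵐ x ∂unitMeas, x ∈ Ico (0 : ℝ) 1 :=
  ae_restrict_mem measurableSet_Ico

/-- Events determined by the first `n` binary digits are independent of the later digits. -/
lemma unitMeas_inter (n : ℕ) {A B : Set ℝ} (hA : MeasurableSet A) (hB : MeasurableSet B)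
    (hAd : ∀ x y : ℝ, ⌊2 ^ n * x⌋ = ⌊2 ^ n * y⌋ → x ∈ A → y ∈ A)
    (hBp : ∀ (y : ℝ) (m : ℤ), y + m ∈ B ↔ y ∈ B) :
    unitMeas (A ∩ {x | 2 ^ n * x ∈ B}) = unitMeas A * unitMeas B := by
  have h2 : (2 : ℝ) ^ n ≠ 0 := by positivity
  have hfl : ∀ t : ℕ, ∀ y ∈ Ico (0 : ℝ) 1, ⌊2 ^ n * ((t + y) / 2 ^ n)⌋ = t := fun t y hy => by
    rw [mul_div_cancel₀ _ h2, Int.floor_eq_iff]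
    push_cast
    exact ⟨by linarith [hy.1], by linarith [hy.2]⟩
  have hAt : ∀ t : ℕ, ∀ y ∈ Ico (0 : ℝ) 1, ((t + y) / 2 ^ n ∈ A ↔ (t : ℝ) / 2 ^ n ∈ A) := by
    intro t y hy
    have h0 := hfl t 0 ⟨le_rfl, one_pos⟩
    rw [add_zero] at h0
    exact ⟨hAd _ _ ((hfl t y hy).trans h0.symm), hAd _ _ (h0.trans (hfl t y hy).symm)⟩
  have hBm : MeasurableSet {x : ℝ | 2 ^ n * x ∈ B} := (measurable_const_mul ((2 : ℝ) ^ n)) hB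
  have key : ∀ E : Set ℝ, MeasurableSet E → (∀ (y : ℝ) (m : ℤ), y + m ∈ E ↔ y ∈ E) →
      unitMeas (A ∩ {x | 2 ^ n * x ∈ E}) = ((2 : ℝ≥0∞) ^ n)⁻¹ *
        (∑ t ∈ Finset.range (2 ^ n), if (t : ℝ) / 2 ^ n ∈ A then 1 else 0) * unitMeas E := by
    intro E hE hEp
    have hEm : MeasurableSet {x : ℝ | 2 ^ n * x ∈ E} := (measurable_const_mul ((2 : ℝ) ^ n)) hE
    conv_lhs => rw [unitMeas_eq_sum_map n]
    rw [Measure.smul_apply, Measure.finsetSum_apply, smul_eq_mul, mul_assoc, Finset.sum_mul]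
    congr 1
    refine Finset.sum_congr rfl fun t _ => ?_
    rw [Measure.map_apply (by fun_prop) (hA.inter hEm)]
    by_cases ht : (t : ℝ) / 2 ^ n ∈ A
    · rw [if_pos ht, one_mul]
      refine measure_congr ?_
      filter_upwards [ae_unitMeas_mem] with y hy
      have e := hEp y t
      push_cast at e
      refine propext ?_
      change ((t + y) / 2 ^ n ∈ A ∧ 2 ^ n * ((t + y) / 2 ^ n) ∈ E) ↔ y ∈ E
      rw [hAt t y hy, mul_div_cancel₀ _ h2, add_comm, e]
      exact and_iff_right ht
    · rw [if_neg ht, zero_mul]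
      rw [measure_eq_zero_iff_ae_notMem]
      filter_upwards [ae_unitMeas_mem] with y hy hmem
      exact ht ((hAt t y hy).mp hmem.1)
  have h1 := key univ MeasurableSet.univ (by simp)
  simp only [mem_univ, ofPred_true, inter_univ, measure_univ, mul_one] at h1
  rw [key B hB hBp, h1]

lemma unitMeas_preimage (n : ℕ) {B : Set ℝ} (hB : MeasurableSet B)
    (hBp : ∀ (y : ℝ) (m : ℤ), y + m ∈ B ↔ y ∈ B) :
    unitMeas {x | 2 ^ n * x ∈ B} = unitMeas B := by
  simpa using unitMeas_inter n MeasurableSet.univ hB (by simp) hBp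

lemma floor_two_pow_mul_congr {m n : ℕ} (hmn : m ≤ n) {x y : ℝ}
    (h : ⌊2 ^ n * x⌋ = ⌊2 ^ n * y⌋) : ⌊2 ^ m * x⌋ = ⌊2 ^ m * y⌋ := by
  obtain ⟨k, rfl⟩ := Nat.exists_eq_add_of_le hmn
  have e : ∀ z : ℝ, ⌊2 ^ m * z⌋ = ⌊2 ^ (m + k) * z⌋ / 2 ^ k := fun z => by
    have := Int.floor_div_natCast (2 ^ (m + k) * z) (2 ^ k)
    push_cast at this
    rw [← this, pow_add]
    congr 1
    field_simp
  rw [e, e, h]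

/-- The strong law of large numbers along the orbit of `x ↦ 2 ^ m * x`. -/
lemma ae_tendsto_average (m : ℕ) {g : ℝ → ℝ} (hg : Measurable g) (C : ℝ) (hC : ∀ x, ‖g x‖ ≤ C)
    (hfl : ∀ x y : ℝ, ⌊2 ^ m * x⌋ = ⌊2 ^ m * y⌋ → g x = g y)
    (hper : ∀ (y : ℝ) (k : ℤ), g (y + k) = g y) :
    ∀ᵐ x ∂unitMeas, Tendsto (fun n : ℕ => (∑ i ∈ Finset.range n, g (2 ^ (m * i) * x)) / n)
      atTop (𝓝 (∫ x, g x ∂unitMeas)) := by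
  have hmeas : ∀ i : ℕ, Measurable fun x : ℝ => g (2 ^ (m * i) * x) := fun i =>
    hg.comp (measurable_const_mul _)
  have hlt : ∀ i j : ℕ, i < j → ProbabilityTheory.IndepFun (fun x : ℝ => g (2 ^ (m * i) * x))
      (fun x => g (2 ^ (m * j) * x)) unitMeas := by
    intro i j hij
    rw [ProbabilityTheory.indepFun_iff_measure_inter_preimage_eq_mul]
    intro s t hs ht
    have h1 := unitMeas_inter (m * j) (hmeas i hs) (hg ht) (fun x y hxy hx => by
      have h2 : m * i + m ≤ m * j := by
        rw [← Nat.mul_succ]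
        exact Nat.mul_le_mul_left m hij
      have h3 := floor_two_pow_mul_congr h2 hxy
      rw [add_comm (m * i), pow_add, mul_assoc, mul_assoc] at h3
      simpa only [mem_preimage, ← hfl _ _ h3] using hx) (fun y k => by simp [hper])
    have h2 := unitMeas_preimage (m * j) (hg ht) (fun y k => by simp [hper])
    rw [← h2] at h1
    exact h1
  have hslln := ProbabilityTheory.strong_law_ae_real (μ := unitMeas)
    (fun (i : ℕ) (x : ℝ) => g (2 ^ (m * i) * x))
    (Integrable.of_bound (hmeas 0).aestronglyMeasurable C (ae_of_all _ fun x => hC _))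
    (fun i j hij => by
      rcases lt_or_gt_of_ne hij with h | h
      exacts [hlt i j h, (hlt j i h).symm])
    (fun i => by
      refine ⟨(hmeas i).aemeasurable, (hmeas 0).aemeasurable, Measure.ext fun s hs => ?_⟩
      rw [Measure.map_apply (hmeas i) hs, Measure.map_apply (hmeas 0) hs]
      have h1 := unitMeas_preimage (m * i) (hg hs) (fun y k => by simp [hper])
      have h2 := unitMeas_preimage (m * 0) (hg hs) (fun y k => by simp [hper])
      exact h1.trans h2.symm)
  simpa using hslln

lemma ae_of_ae_unitMeas {p : ℝ → Prop} (hp : ∀ (x : ℝ) (m : ℤ), p x → p (x + m))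
    (h : ∀ᵐ x ∂unitMeas, p x) : ∀ᵐ x : ℝ, p x := by
  rw [unitMeas, ae_restrict_iff' measurableSet_Ico] at h
  have h1 : ∀ m : ℤ, ∀ᵐ x : ℝ, x - m ∈ Ico (0 : ℝ) 1 → p (x - m) := fun m =>
    (measurePreserving_sub_right volume (m : ℝ)).quasiMeasurePreserving.ae h
  filter_upwards [ae_all_iff.mpr h1] with x hx
  have := hp _ ⌊x⌋ (hx ⌊x⌋ ⟨Int.fract_nonneg x, Int.fract_lt_one x⟩)
  rwa [sub_add_cancel] at this

end Doubling

section Distortion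

variable {d : Fin 3 → ℕ} {M : ℕ}

/-- The points whose first `J` blocks of `l` binary digits all differ from the block `u`. -/
def blockAvoid (l u J : ℕ) : Set ℝ :=
  {y | ∀ j < J, ⌊2 ^ l * Int.fract (2 ^ (j * l) * y)⌋ ≠ u}

lemma measurableSet_blockAvoid (l u J : ℕ) : MeasurableSet (blockAvoid l u J) := by
  have : blockAvoid l u J = ⋂ j : ℕ, ⋂ _ : j < J,
      (fun y : ℝ => ⌊2 ^ l * Int.fract (2 ^ (j * l) * y)⌋) ⁻¹' {(u : ℤ)}ᶜ := by
    ext y; simp [blockAvoid]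
  rw [this]
  refine MeasurableSet.iInter fun j => MeasurableSet.iInter fun _ => ?_
  have hm : Measurable fun y : ℝ => ⌊2 ^ l * Int.fract (2 ^ (j * l) * y)⌋ :=
    Int.measurable_floor.comp
      (measurable_const.mul (measurable_fract.comp (measurable_const_mul _)))
  exact hm (measurableSet_singleton _).compl

lemma blockAvoid_add_int (l u J : ℕ) (y : ℝ) (m : ℤ) :
    y + m ∈ blockAvoid l u J ↔ y ∈ blockAvoid l u J := by
  have e : ∀ j : ℕ, Int.fract (2 ^ (j * l) * (y + m)) = Int.fract (2 ^ (j * l) * y) := fun j => by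
    have : 2 ^ (j * l) * (y + m) = 2 ^ (j * l) * y + ((2 ^ (j * l) * m : ℤ) : ℝ) := by
      push_cast; ring
    rw [this, Int.fract_add_intCast]
  simp only [blockAvoid, mem_ofPred_eq, e]

lemma unitMeas_blockAvoid (l u J : ℕ) :
    unitMeas (blockAvoid l u J) = unitMeas (blockAvoid l u 1) ^ J := by
  induction J with
  | zero => simp [blockAvoid]
  | succ J ih =>
    have e : blockAvoid l u (J + 1) = blockAvoid l u 1 ∩ {x | 2 ^ l * x ∈ blockAvoid l u J} := by
      ext y
      simp only [blockAvoid, mem_ofPred_eq, mem_inter_iff, Nat.lt_one_iff, forall_eq, ← mul_assoc,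
        ← pow_add, ← Nat.succ_mul]
      constructor
      · exact fun h => ⟨h 0 (by omega), fun j hj => h (j + 1) (by omega)⟩
      · rintro ⟨h0, h1⟩ (_ | j) hj
        exacts [h0, h1 j (by omega)]
    rw [e, unitMeas_inter l (measurableSet_blockAvoid _ _ _) (measurableSet_blockAvoid _ _ _) _
      (blockAvoid_add_int l u J), ih, pow_succ']
    intro x y hxy hx
    simp only [blockAvoid, mem_ofPred_eq, Nat.lt_one_iff, forall_eq, zero_mul, pow_zero,
      one_mul] at hx ⊢
    have := floor_two_pow_mul_add_fract l 0 hxy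
    simp only [Nat.cast_zero, zero_add] at this
    rwa [← this]

lemma unitMeas_blockAvoid_one_lt {l u : ℕ} (hu : u < 2 ^ l) : unitMeas (blockAvoid l u 1) < 1 := by
  have h2 : (0 : ℝ) < 2 ^ l := by positivity
  have hsub : Ico ((u : ℝ) / 2 ^ l) ((u + 1) / 2 ^ l) ⊆ (blockAvoid l u 1)ᶜ ∩ Ico 0 1 := by
    intro y hy
    have h3 : (u : ℝ) + 1 ≤ 2 ^ l := by exact_mod_cast hu
    have h0 : 0 ≤ y := le_trans (by positivity) hy.1
    have h1 : y < 1 := hy.2.trans_le (by rwa [div_le_one h2])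
    refine ⟨fun h => h 0 one_pos ?_, h0, h1⟩
    rw [zero_mul, pow_zero, one_mul, Int.fract_eq_self.mpr ⟨h0, h1⟩, Int.floor_eq_iff]
    have h4 := (div_le_iff₀ h2).mp hy.1
    have h5 := (lt_div_iff₀ h2).mp hy.2
    push_cast
    constructor <;> linarith
  have hpos : 0 < unitMeas (blockAvoid l u 1)ᶜ := by
    rw [unitMeas, Measure.restrict_apply (measurableSet_blockAvoid _ _ _).compl]
    refine lt_of_lt_of_le ?_ (measure_mono hsub)
    rw [Real.volume_Ico, ENNReal.ofReal_pos, ← sub_div]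
    have : (u : ℝ) + 1 - u = 1 := by ring
    rw [this]
    positivity
  rw [← compl_compl (blockAvoid l u 1),
    prob_compl_eq_one_sub (measurableSet_blockAvoid _ _ _).compl]
  exact ENNReal.sub_lt_self ENNReal.one_ne_top one_ne_zero hpos.ne'

lemma unitMeas_preimage_blockAvoid (l u J k : ℕ) :
    unitMeas {x | 2 ^ k * x ∈ blockAvoid l u J} = unitMeas (blockAvoid l u 1) ^ J := by
  rw [unitMeas_preimage k (measurableSet_blockAvoid _ _ _) (blockAvoid_add_int l u J),
    unitMeas_blockAvoid]

lemma ae_exists_block {l u : ℕ} (hu : u < 2 ^ l) :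
    ∀ᵐ x ∂unitMeas, ∀ k : ℕ, ∃ J : ℕ, 2 ^ k * x ∉ blockAvoid l u J := by
  refine ae_all_iff.mpr fun k => ?_
  have hq := unitMeas_blockAvoid_one_lt hu
  rw [ae_iff]
  refine le_antisymm (ge_of_tendsto' (ENNReal.tendsto_pow_atTop_nhds_zero_of_lt_one hq)
    fun J => ?_) zero_le
  rw [← unitMeas_preimage_blockAvoid l u J k]
  refine measure_mono fun x hx => ?_
  simp only [not_exists, not_not, mem_ofPred_eq] at hx
  exact hx J

lemma ae_eventually_exists_block {l u : ℕ} (hu : u < 2 ^ l) :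
    ∀ᵐ x ∂unitMeas, ∀ r : ℕ, ∀ᶠ k : ℕ in atTop,
      2 ^ k * x ∉ blockAvoid l u (k / (r + 1) + 1) := by
  refine ae_all_iff.mpr fun r => ?_
  have hq := unitMeas_blockAvoid_one_lt hu
  refine ae_eventually_notMem (s := fun k => {x | 2 ^ k * x ∈ blockAvoid l u (k / (r + 1) + 1)}) ?_
  simp only [unitMeas_preimage_blockAvoid]
  set q := unitMeas (blockAvoid l u 1)
  set ρ : ℝ≥0∞ := q ^ ((r + 1 : ℕ) : ℝ)⁻¹ with hρ
  have hr : (0 : ℝ) < ((r + 1 : ℕ) : ℝ)⁻¹ := by positivity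
  have hρ1 : ρ < 1 := ENNReal.rpow_lt_one hq hr
  have hρq : ρ ^ (r + 1) = q := by
    rw [hρ, ← ENNReal.rpow_natCast, ← ENNReal.rpow_mul, inv_mul_cancel₀ (by positivity),
      ENNReal.rpow_one]
  refine ne_top_of_le_ne_top ?_ (ENNReal.tsum_le_tsum (g := fun k => ρ ^ k) fun k => ?_)
  · rw [ENNReal.tsum_geometric]
    exact ENNReal.inv_ne_top.mpr (tsub_pos_of_lt hρ1).ne'
  · rw [← hρq, ← pow_mul]
    refine pow_le_pow_right_of_le_one' hρ1.le ?_
    have := Nat.lt_mul_div_succ k (Nat.succ_pos r)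
    exact this.le

/-- Almost surely the counts over a fibre are comparable up to a subexponential factor. -/
lemma ae_fiberSum_le_mul_fiberMin (hd : IsDigitSystem d M) :
    ∀ᵐ x ∂unitMeas, ∀ ε > 0, ∃ C > 0, ∀ k n : ℕ,
      fiberSum d M n (2 ^ k * x) ≤ C * Real.exp (ε * k) * fiberMin d M n (2 ^ k * x) := by
  obtain ⟨l, u, hul, hu⟩ := exists_synchronizing_interval hd
  have hM : (1 : ℝ) ≤ M := by exact_mod_cast hd.pos
  have h3 : (1 : ℝ) ≤ 3 ^ l := one_le_pow₀ (by norm_num)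
  set B : ℝ := M * (M * 3 ^ l) with hB
  have hB1 : 1 ≤ B := one_le_mul_of_one_le_of_one_le hM (one_le_mul_of_one_le_of_one_le hM h3)
  have hB0 : 0 < B := by linarith
  have hvisit : ∀ (J : ℕ) (y : ℝ), y ∉ blockAvoid l u J → ∀ n,
      fiberSum d M n y ≤ B ^ J * fiberMin d M n y := by
    intro J y hy n
    simp only [blockAvoid, mem_ofPred_eq, not_forall, not_not] at hy
    obtain ⟨j, hj, hjy⟩ := hy
    refine (fiberSum_le_of_visit hd hu j y hjy n).trans ?_
    have := one_le_fiberMin hd n y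
    gcongr
    exact hj
  filter_upwards [ae_exists_block hul, ae_eventually_exists_block hul] with x hx1 hx2 ε hε
  choose J hJ using hx1
  obtain ⟨r, hr⟩ := exists_nat_gt (Real.log B / ε)
  obtain ⟨k₀, hk₀⟩ := eventually_atTop.mp (hx2 r)
  refine ⟨B + ∑ k ∈ Finset.range k₀, B ^ J k, by positivity, fun k n => ?_⟩
  have hmin := zero_le_one.trans (one_le_fiberMin hd n (2 ^ k * x))
  have hexp : 1 ≤ Real.exp (ε * k) := Real.one_le_exp (by positivity)
  have hsum : 0 ≤ ∑ k ∈ Finset.range k₀, B ^ J k := by positivity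
  rcases lt_or_ge k k₀ with hk | hk
  · refine (hvisit _ _ (hJ k) n).trans (mul_le_mul_of_nonneg_right ?_ hmin)
    have : B ^ J k ≤ ∑ k ∈ Finset.range k₀, B ^ J k :=
      Finset.single_le_sum (f := fun k => B ^ J k) (fun _ _ => by positivity)
        (Finset.mem_range.mpr hk)
    nlinarith
  · refine (hvisit _ _ (hk₀ k hk) n).trans (mul_le_mul_of_nonneg_right ?_ hmin)
    have hpow : B ^ (k / (r + 1)) ≤ Real.exp (ε * k) := by
      rw [← Real.exp_log (pow_pos hB0 _), Real.log_pow]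
      refine Real.exp_le_exp.mpr ?_
      have h4 : ((k / (r + 1) : ℕ) : ℝ) ≤ k / (r + 1) := by
        have := Nat.cast_div_le (α := ℝ) (m := k) (n := r + 1)
        push_cast at this
        exact this
      have h5 : Real.log B ≤ ε * (r + 1) := by
        rw [div_lt_iff₀ hε] at hr
        linarith
      calc ((k / (r + 1) : ℕ) : ℝ) * Real.log B ≤ k / (r + 1) * (ε * (r + 1)) :=
            mul_le_mul h4 h5 (Real.log_nonneg hB1) (by positivity)
        _ = ε * k := by field_simp
    rw [pow_succ]
    nlinarith

end Distortion

section Growth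

variable {d : Fin 3 → ℕ} {M : ℕ}

lemma tendsto_div_of_average {a : ℕ → ℝ} {I : ℝ} {m : ℕ} (hm : 0 < m)
    (h : Tendsto (fun n : ℕ => a n / n) atTop (𝓝 I)) :
    Tendsto (fun n : ℕ => a (n / m) / n) atTop (𝓝 (I / m)) := by
  have h1 : Tendsto (fun n : ℕ => ((n / m : ℕ) : ℝ) / n) atTop (𝓝 (m : ℝ)⁻¹) := by
    have := (tendsto_nat_floor_mul_div_atTop (R := ℝ) (a := (m : ℝ)⁻¹) (by positivity)).comp
      tendsto_natCast_atTop_atTop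
    refine this.congr fun n => ?_
    rw [Function.comp_apply, inv_mul_eq_div, Nat.floor_div_eq_div]
  have h2 := (h.comp (Nat.tendsto_div_const_atTop hm.ne')).mul h1
  rw [div_eq_mul_inv]
  refine h2.congr' ?_
  filter_upwards [eventually_ge_atTop m] with n hn
  have : ((n / m : ℕ) : ℝ) ≠ 0 := by
    have := Nat.div_pos hn hm
    positivity
  simp only [Function.comp_apply]
  field_simp

lemma fiberSum_mul_le (hd : IsDigitSystem d M) (m k : ℕ) (x : ℝ) :
    fiberSum d M (m * k) x ≤ M * ∏ i ∈ Finset.range k, fiberSum d M m (2 ^ (m * i) * x) := by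
  induction k with
  | zero => simpa using fiberSum_le (d := d) (M := M) 0 x
  | succ k ih =>
    rw [Finset.prod_range_succ, ← mul_assoc, Nat.mul_succ]
    exact (fiberSum_add_le hd _ _ _).trans (mul_le_mul_of_nonneg_right ih
      (zero_le_one.trans (one_le_fiberSum hd _ _)))

lemma le_fiberMin_mul (hd : IsDigitSystem d M) (m k : ℕ) (x : ℝ) :
    ∏ i ∈ Finset.range k, fiberMin d M m (2 ^ (m * i) * x) ≤ fiberMin d M (m * k) x := by
  induction k with
  | zero => simpa using one_le_fiberMin hd 0 x
  | succ k ih =>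
    rw [Finset.prod_range_succ, Nat.mul_succ]
    exact (mul_le_mul_of_nonneg_right ih (zero_le_one.trans (one_le_fiberMin hd _ _))).trans
      (le_fiberMin_add hd _ _ _)

lemma log_fiberSum_le (hd : IsDigitSystem d M) {m : ℕ} (hm : 0 < m) (n : ℕ) (x : ℝ) :
    Real.log (fiberSum d M n x) ≤ Real.log (M * (M * 3 ^ m)) +
      ∑ i ∈ Finset.range (n / m), Real.log (fiberSum d M m (2 ^ (m * i) * x)) := by
  have hM : (0 : ℝ) < M := by exact_mod_cast hd.pos
  have hpos : ∀ m y, 0 < fiberSum d M m y := fun m y => one_pos.trans_le (one_le_fiberSum hd m y)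
  have hprod : 0 < ∏ i ∈ Finset.range (n / m), fiberSum d M m (2 ^ (m * i) * x) :=
    Finset.prod_pos fun i _ => hpos _ _
  rw [← Real.log_prod fun i _ => (hpos _ _).ne', ← Real.log_mul (by positivity) hprod.ne']
  refine Real.log_le_log (hpos _ _) ?_
  conv_lhs => rw [← Nat.div_add_mod n m]
  calc fiberSum d M (m * (n / m) + n % m) x
      ≤ fiberSum d M (m * (n / m)) x * fiberSum d M (n % m) (2 ^ (m * (n / m)) * x) :=
        fiberSum_add_le hd _ _ _
    _ ≤ (M * ∏ i ∈ Finset.range (n / m), fiberSum d M m (2 ^ (m * i) * x)) * (M * 3 ^ m) := by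
        refine mul_le_mul (fiberSum_mul_le hd _ _ _) ?_ (hpos _ _).le (by positivity)
        refine (fiberSum_le _ _).trans ?_
        gcongr
        · norm_num
        · exact (Nat.mod_lt _ hm).le
    _ = _ := by ring

lemma sum_log_fiberMin_le (hd : IsDigitSystem d M) (m n : ℕ) (x : ℝ) :
    ∑ i ∈ Finset.range (n / m), Real.log (fiberMin d M m (2 ^ (m * i) * x)) ≤
      Real.log (fiberMin d M n x) := by
  have hpos : ∀ m y, 0 < fiberMin d M m y := fun m y => one_pos.trans_le (one_le_fiberMin hd m y)
  rw [← Real.log_prod fun i _ => (hpos _ _).ne']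
  refine Real.log_le_log (Finset.prod_pos fun i _ => hpos _ _) ((le_fiberMin_mul hd _ _ _).trans ?_)
  conv_rhs => rw [← Nat.div_add_mod n m]
  exact (le_mul_of_one_le_right (hpos _ _).le (one_le_fiberMin hd _ _)).trans
    (le_fiberMin_add hd _ _ _)

/-- The mean logarithmic growth rate of `fiberSum`. -/
def upperRate (d : Fin 3 → ℕ) (M m : ℕ) : ℝ := (∫ x, Real.log (fiberSum d M m x) ∂unitMeas) / m

/-- The mean logarithmic growth rate of `fiberMin`. -/
def lowerRate (d : Fin 3 → ℕ) (M m : ℕ) : ℝ := (∫ x, Real.log (fiberMin d M m x) ∂unitMeas) / m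

lemma norm_log_fiberSum_le (hd : IsDigitSystem d M) (m : ℕ) (x : ℝ) :
    ‖Real.log (fiberSum d M m x)‖ ≤ Real.log (M * 3 ^ m) := by
  have h1 := one_le_fiberSum hd m x
  rw [Real.norm_of_nonneg (Real.log_nonneg h1)]
  exact Real.log_le_log (by linarith) (fiberSum_le m x)

lemma norm_log_fiberMin_le (hd : IsDigitSystem d M) (m : ℕ) (x : ℝ) :
    ‖Real.log (fiberMin d M m x)‖ ≤ Real.log (M * 3 ^ m) := by
  have h1 := one_le_fiberMin hd m x
  rw [Real.norm_of_nonneg (Real.log_nonneg h1)]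
  exact Real.log_le_log (by linarith) ((fiberMin_le_fiberSum hd m x).trans (fiberSum_le m x))

lemma integrable_log_fiberSum (hd : IsDigitSystem d M) (m : ℕ) :
    Integrable (fun x => Real.log (fiberSum d M m x)) unitMeas :=
  Integrable.of_bound (measurable_fiberSum m).log.aestronglyMeasurable _
    (ae_of_all _ (norm_log_fiberSum_le hd m))

lemma integrable_log_fiberMin (hd : IsDigitSystem d M) (m : ℕ) :
    Integrable (fun x => Real.log (fiberMin d M m x)) unitMeas :=
  Integrable.of_bound (measurable_fiberMin m).log.aestronglyMeasurable _
    (ae_of_all _ (norm_log_fiberMin_le hd m))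

lemma ae_eventually_log_fiberSum_le (hd : IsDigitSystem d M) :
    ∀ᵐ x ∂unitMeas, ∀ m : ℕ, 0 < m → ∀ ε > 0, ∀ᶠ n : ℕ in atTop,
      Real.log (fiberSum d M n x) / n ≤ upperRate d M m + ε := by
  refine ae_all_iff.mpr fun m => ?_
  have h := ae_tendsto_average m (g := fun x => Real.log (fiberSum d M m x))
    (measurable_fiberSum m).log _ (norm_log_fiberSum_le hd m)
    (fun x y h => by rw [fiberSum_congr_floor m h]) (fun y k => by rw [fiberSum_add_int])
  filter_upwards [h] with x hx hm ε hε
  have h1 := (tendsto_const_div_atTop_nhds_zero_nat (Real.log (M * (M * 3 ^ m)))).add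
    (tendsto_div_of_average hm hx)
  rw [zero_add] at h1
  filter_upwards [h1.eventually_lt_const (lt_add_of_pos_right _ hε)] with n hn
  refine le_trans ?_ hn.le
  rw [← add_div]
  exact div_le_div_of_nonneg_right (log_fiberSum_le hd hm n x) (Nat.cast_nonneg n)

lemma ae_eventually_le_log_fiberMin (hd : IsDigitSystem d M) :
    ∀ᵐ x ∂unitMeas, ∀ m : ℕ, 0 < m → ∀ ε > 0, ∀ᶠ n : ℕ in atTop,
      lowerRate d M m - ε ≤ Real.log (fiberMin d M n x) / n := by
  refine ae_all_iff.mpr fun m => ?_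
  have h := ae_tendsto_average m (g := fun x => Real.log (fiberMin d M m x))
    (measurable_fiberMin m).log _ (norm_log_fiberMin_le hd m)
    (fun x y h => by rw [fiberMin_congr_floor m h]) (fun y k => by rw [fiberMin_add_int])
  filter_upwards [h] with x hx hm ε hε
  have h1 := tendsto_div_of_average hm hx
  filter_upwards [h1.eventually_const_lt (sub_lt_self _ hε)] with n hn
  exact hn.le.trans (div_le_div_of_nonneg_right (sum_log_fiberMin_le hd m n x) (Nat.cast_nonneg n))

lemma tendsto_upperRate_sub_lowerRate (hd : IsDigitSystem d M) :
    Tendsto (fun m => upperRate d M m - lowerRate d M m) atTop (𝓝 0) := by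
  have hM : (1 : ℝ) ≤ M := by exact_mod_cast hd.pos
  have e : ∀ m, upperRate d M m - lowerRate d M m =
      ∫ x, (Real.log (fiberSum d M m x) - Real.log (fiberMin d M m x)) / m ∂unitMeas := fun m => by
    rw [upperRate, lowerRate, ← sub_div, integral_div,
      integral_sub (integrable_log_fiberSum hd m) (integrable_log_fiberMin hd m)]
  have hlog : ∀ m x, Real.log (fiberMin d M m x) ≤ Real.log (fiberSum d M m x) := fun m x =>
    Real.log_le_log (zero_lt_one.trans_le (one_le_fiberMin hd m x)) (fiberMin_le_fiberSum hd m x)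
  simp only [e]
  rw [← integral_zero ℝ ℝ (μ := unitMeas)]
  refine tendsto_integral_of_dominated_convergence (fun _ => Real.log M + Real.log 3)
    (fun m => (((measurable_fiberSum m).log.sub
      (measurable_fiberMin m).log).div_const _).aestronglyMeasurable)
    (integrable_const _) (fun m => ae_of_all _ fun x => ?_) ?_
  · have h1 := norm_log_fiberSum_le hd m x
    rw [Real.norm_of_nonneg (Real.log_nonneg (one_le_fiberSum hd m x)),
      Real.log_mul (by positivity) (by positivity), Real.log_pow] at h1
    have h2 := Real.log_nonneg (one_le_fiberMin hd m x)
    have h3 := Real.log_nonneg hM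
    have h4 := Real.log_nonneg (show (1 : ℝ) ≤ 3 by norm_num)
    rw [Real.norm_of_nonneg (div_nonneg (sub_nonneg.mpr (hlog m x)) (Nat.cast_nonneg m))]
    rcases Nat.eq_zero_or_pos m with rfl | hm
    · simp only [Nat.cast_zero, div_zero]; positivity
    · have hm1 : (1 : ℝ) ≤ m := by exact_mod_cast hm
      rw [div_le_iff₀ (by positivity)]
      nlinarith
  · filter_upwards [ae_fiberSum_le_mul_fiberMin hd] with x hx
    obtain ⟨C, hC, h⟩ := hx 1 one_pos
    refine squeeze_zero (fun m => div_nonneg (sub_nonneg.mpr (hlog m x)) (Nat.cast_nonneg m))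
      (fun m => ?_) (tendsto_const_div_atTop_nhds_zero_nat (Real.log C))
    refine div_le_div_of_nonneg_right ?_ (Nat.cast_nonneg m)
    have h1 := h 0 m
    simp only [pow_zero, one_mul, Nat.cast_zero, mul_zero, Real.exp_zero, mul_one] at h1
    have h2 := one_le_fiberMin hd m x
    rw [sub_le_iff_le_add, ← Real.log_mul hC.ne' (by positivity)]
    exact Real.log_le_log (zero_lt_one.trans_le (one_le_fiberSum hd m x)) h1

lemma integrable_sqrt_fiberSum (m : ℕ) :
    Integrable (fun x => √(fiberSum d M m x)) unitMeas :=
  Integrable.of_bound (measurable_fiberSum m).sqrt.aestronglyMeasurable √(M * 3 ^ m)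
    (ae_of_all _ fun x => by
      rw [Real.norm_of_nonneg (Real.sqrt_nonneg _)]
      exact Real.sqrt_le_sqrt (fiberSum_le m x))

lemma one_le_integral_sqrt (hd : IsDigitSystem d M) (m : ℕ) :
    1 ≤ ∫ x, √(fiberSum d M m x) ∂unitMeas := by
  have h : ∫ _x, (1 : ℝ) ∂unitMeas = 1 := by simp
  rw [← h]
  exact integral_mono (integrable_const _) (integrable_sqrt_fiberSum m) fun x =>
    Real.one_le_sqrt.mpr (one_le_fiberSum hd m x)

/-- Jensen's inequality for the growth rate. -/
lemma upperRate_le (hd : IsDigitSystem d M) (m : ℕ) :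
    upperRate d M m ≤ 2 * Real.log (∫ x, √(fiberSum d M m x) ∂unitMeas) / m := by
  refine div_le_div_of_nonneg_right ?_ (Nat.cast_nonneg m)
  set I := ∫ x, √(fiberSum d M m x) ∂unitMeas with hI
  have hI0 : 0 < I := zero_lt_one.trans_le (one_le_integral_sqrt hd m)
  have hint := integrable_sqrt_fiberSum (d := d) (M := M) m
  calc ∫ x, Real.log (fiberSum d M m x) ∂unitMeas
      ≤ ∫ x, 2 * (√(fiberSum d M m x) / I + (Real.log I - 1)) ∂unitMeas := by
        refine integral_mono (integrable_log_fiberSum hd m)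
          (((hint.div_const I).add (integrable_const _)).const_mul 2) fun x => ?_
        have h1 := zero_lt_one.trans_le (one_le_fiberSum hd m x)
        have h2 := Real.log_le_sub_one_of_pos (div_pos (Real.sqrt_pos.mpr h1) hI0)
        rw [Real.log_div (Real.sqrt_pos.mpr h1).ne' hI0.ne', Real.log_sqrt h1.le] at h2
        simp only
        linarith
    _ = 2 * Real.log I := by
        rw [integral_const_mul, integral_add (hint.div_const I) (integrable_const _), integral_div,
          ← hI, div_self hI0.ne']
        simp

lemma integral_sqrt_fiberSum_add_le {K : ℕ} {c : ℝ}
    (h : ∀ m : ℕ, ∀ x : ℝ, 0 ≤ x → x < 1 →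
      ∑ t ∈ Finset.range (2 ^ K), √(fiberSum d M (K + m) ((t + x) / 2 ^ K)) ≤
        2 ^ K * c * √(fiberSum d M m x)) (m : ℕ) :
    ∫ x, √(fiberSum d M (K + m) x) ∂unitMeas ≤ c * ∫ x, √(fiberSum d M m x) ∂unitMeas := by
  rw [integral_unitMeas_eq K (measurable_fiberSum (K + m)).sqrt √(M * 3 ^ (K + m)) fun x => by
    rw [Real.norm_of_nonneg (Real.sqrt_nonneg _)]
    exact Real.sqrt_le_sqrt (fiberSum_le _ x), inv_mul_le_iff₀ (by positivity), ← mul_assoc,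
    ← integral_const_mul]
  refine integral_mono_of_nonneg (ae_of_all _ fun x => Finset.sum_nonneg fun _ _ =>
    Real.sqrt_nonneg _) ((integrable_sqrt_fiberSum m).const_mul _) ?_
  filter_upwards [ae_unitMeas_mem] with x hx
  exact h m x hx.1 hx.2

lemma exists_upperRate_lt (hd : IsDigitSystem d M) :
    ∃ m, 0 < m ∧ upperRate d M m < Real.log (3 / 2) := by
  obtain ⟨K, hK, c₀, hc₀, hc₁, h⟩ := exists_sum_sqrt_fiberSum_le hd
  have hstep := integral_sqrt_fiberSum_add_le h
  have hM : (0 : ℝ) < M := by exact_mod_cast hd.pos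
  have hc : 0 < c₀ := by
    rcases hc₀.eq_or_lt with rfl | h0
    · have h1 := hstep 0
      have h2 := one_le_integral_sqrt hd (K + 0)
      rw [zero_mul] at h1
      linarith
    · exact h0
  have hiter : ∀ n, ∫ x, √(fiberSum d M (K * n) x) ∂unitMeas ≤
      c₀ ^ n * ∫ x, √(fiberSum d M 0 x) ∂unitMeas := by
    intro n
    induction n with
    | zero => simp
    | succ n ih =>
      rw [Nat.mul_succ, add_comm, pow_succ', mul_assoc]
      exact (hstep _).trans (mul_le_mul_of_nonneg_left ih hc₀)
  set I := ∫ x, √(fiberSum d M 0 x) ∂unitMeas with hI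
  have hI0 : 0 < I := zero_lt_one.trans_le (one_le_integral_sqrt hd 0)
  have hlogc : 2 * Real.log c₀ / K < Real.log (3 / 2) := by
    have h1 := Real.log_lt_log hc hc₁
    rw [Real.log_sqrt (by positivity), Real.log_pow] at h1
    have hK' : (0 : ℝ) < K := by exact_mod_cast hK
    rw [div_lt_iff₀ hK']
    linarith
  have hlim : Tendsto (fun n : ℕ => 2 * Real.log c₀ / K + (2 * Real.log I / K) / n) atTop
      (𝓝 (2 * Real.log c₀ / K)) := by
    simpa using (tendsto_const_nhds (x := 2 * Real.log c₀ / K)).add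
      (tendsto_const_div_atTop_nhds_zero_nat (2 * Real.log I / K))
  obtain ⟨n, hn, hn0⟩ := ((hlim.eventually_lt_const hlogc).and (eventually_gt_atTop 0)).exists
  refine ⟨K * n, Nat.mul_pos hK hn0, lt_of_le_of_lt ?_ hn⟩
  refine (upperRate_le hd _).trans ?_
  have h1 := Real.log_le_log (zero_lt_one.trans_le (one_le_integral_sqrt hd (K * n))) (hiter n)
  rw [Real.log_mul (by positivity) hI0.ne', Real.log_pow] at h1
  have hK' : (0 : ℝ) < K := by exact_mod_cast hK
  have hn' : (0 : ℝ) < n := by exact_mod_cast hn0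
  push_cast
  rw [div_le_iff₀ (by positivity)]
  calc _ ≤ 2 * (n * Real.log c₀ + Real.log I) := by linarith
    _ = _ := by field_simp

/-- The counts over almost every fibre grow at the same exponential rate, which is strictly
smaller than the mean growth rate `log (3 / 2)`, and they are comparable along the orbit. -/
theorem exists_growth_rate (hd : IsDigitSystem d M) :
    ∃ β : ℝ, 0 ≤ β ∧ β < Real.log (3 / 2) ∧ ∀ᵐ x : ℝ,
      Tendsto (fun n : ℕ => Real.log (fiberSum d M n x) / n) atTop (𝓝 β) ∧
      ∀ ε > 0, ∃ C > 0, ∀ k n : ℕ,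
        fiberSum d M n (2 ^ k * x) ≤ C * Real.exp (ε * k) * fiberMin d M n (2 ^ k * x) := by
  have hgood := (ae_eventually_log_fiberSum_le hd).and
    ((ae_eventually_le_log_fiberMin hd).and (ae_fiberSum_le_mul_fiberMin hd))
  have hlog : ∀ m x, Real.log (fiberMin d M m x) / m ≤ Real.log (fiberSum d M m x) / m :=
    fun m x => div_le_div_of_nonneg_right (Real.log_le_log
      (zero_lt_one.trans_le (one_le_fiberMin hd m x)) (fiberMin_le_fiberSum hd m x))
      (Nat.cast_nonneg m)
  have hLU : ∀ m, 0 < m → ∀ m', 0 < m' → lowerRate d M m ≤ upperRate d M m' := by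
    intro m hm m' hm'
    obtain ⟨x, hx1, hx2, -⟩ := hgood.exists
    refine le_of_forall_pos_le_add fun ε hε => ?_
    obtain ⟨n, h1, h2⟩ :=
      ((hx1 m' hm' (ε / 2) (half_pos hε)).and (hx2 m hm (ε / 2) (half_pos hε))).exists
    have := hlog n x
    linarith
  have hU0 : ∀ m, 0 ≤ upperRate d M m := fun m =>
    div_nonneg (integral_nonneg fun x => Real.log_nonneg (one_le_fiberSum hd m x))
      (Nat.cast_nonneg m)
  have hbdd : BddBelow (range fun m => upperRate d M (m + 1)) :=
    ⟨0, forall_mem_range.mpr fun m => hU0 _⟩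
  set β := ⨅ m, upperRate d M (m + 1) with hβ
  have hβU : ∀ m, 0 < m → β ≤ upperRate d M m := fun m hm => by
    obtain ⟨k, rfl⟩ := Nat.exists_eq_succ_of_ne_zero hm.ne'
    exact ciInf_le hbdd k
  have hLβ : ∀ m, 0 < m → lowerRate d M m ≤ β := fun m hm =>
    le_ciInf fun k => hLU m hm _ k.succ_pos
  obtain ⟨m₀, hm₀, hlt⟩ := exists_upperRate_lt hd
  refine ⟨β, le_ciInf fun m => hU0 _, (hβU m₀ hm₀).trans_lt hlt, ?_⟩
  refine ae_of_ae_unitMeas (fun x m hx => ?_) ?_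
  · have e : ∀ k : ℕ, 2 ^ k * (x + m) = 2 ^ k * x + ((2 ^ k * m : ℤ) : ℝ) := fun k => by
      push_cast; ring
    simpa only [e, fiberSum_add_int, fiberMin_add_int] using hx
  filter_upwards [hgood] with x hx
  obtain ⟨h1, h2, h3⟩ := hx
  refine ⟨?_, h3⟩
  rw [Metric.tendsto_nhds]
  intro ε hε
  obtain ⟨m, hm, hm0⟩ := (((tendsto_upperRate_sub_lowerRate hd).eventually_lt_const
    (show (0 : ℝ) < ε / 2 by linarith)).and (eventually_gt_atTop 0)).exists
  filter_upwards [h1 m hm0 (ε / 3) (by linarith), h2 m hm0 (ε / 3) (by linarith)] with n hn1 hn2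
  have h4 := hβU m hm0
  have h5 := hLβ m hm0
  have h6 := hlog n x
  rw [Real.dist_eq, abs_lt]
  constructor <;> linarith

end Growth

section Dimensions

variable {X : Type*} [MetricSpace X]

lemma dimH_le_of_covers {E : Set X} {β R : ℝ} (hβ : 0 ≤ β) (hR : 0 < R)
    (h : ∀ ε > 0, ∃ C > 0, ∀ n : ℕ, ∃ F : Finset X, (F.card : ℝ) ≤ C * Real.exp ((β + ε) * n) ∧
      E ⊆ ⋃ x ∈ F, closedBall x (R / 2 ^ n)) :
    dimH E ≤ ENNReal.ofReal (β / Real.log 2) := by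
  borelize X
  have hl2 : 0 < Real.log 2 := Real.log_pos (by norm_num)
  refine ENNReal.le_of_forall_pos_le_add fun δ hδ _ => ?_
  have hδ' : (0 : ℝ) < δ := hδ
  set s : ℝ := β / Real.log 2 + δ with hs
  have hs0 : 0 < s := by positivity
  set ε : ℝ := δ * Real.log 2 / 2 with hε
  obtain ⟨C, hC, hF⟩ := h ε (by positivity)
  choose F hcard hcov using hF
  have hx : (β + ε) - s * Real.log 2 < 0 := by
    have : s * Real.log 2 = β + δ * Real.log 2 := by rw [hs]; field_simp
    rw [this, hε]; nlinarith [mul_pos hδ' hl2]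
  have hR2 : Tendsto (fun n : ℕ => 2 * (R / 2 ^ n)) atTop (𝓝 0) := by
    have := (tendsto_pow_atTop_nhds_zero_of_lt_one (r := (1 / 2 : ℝ)) (by norm_num)
      (by norm_num)).const_mul (2 * R)
    rw [mul_zero] at this
    refine this.congr fun n => ?_
    rw [div_pow, one_pow]; ring
  have hdiam : ∀ (n : ℕ) (x : X), ediam (closedBall x (R / 2 ^ n)) ≤
      ENNReal.ofReal (2 * (R / 2 ^ n)) := fun n x => by
    refine ediam_le_of_forall_dist_le fun y hy z hz => ?_
    have := dist_triangle_right y z x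
    rw [mem_closedBall] at hy hz
    linarith
  have hzero : μH[s] E = 0 := by
    refine le_antisymm ?_ bot_le
    refine (Measure.hausdorffMeasure_le_liminf_sum (l := atTop) (ι := fun n => F n) s E
      (fun n : ℕ => ENNReal.ofReal (2 * (R / 2 ^ n))) ?_
      (fun n x => closedBall (x : X) (R / 2 ^ n)) ?_ ?_).trans ?_
    · simpa using ENNReal.tendsto_ofReal hR2
    · exact Eventually.of_forall fun n x => hdiam n x
    · refine Eventually.of_forall fun n => (hcov n).trans ?_
      refine iUnion₂_subset fun x hx => ?_
      exact subset_iUnion (fun x : F n => closedBall (x : X) (R / 2 ^ n)) ⟨x, hx⟩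
    · have hlim : Tendsto (fun n : ℕ => ENNReal.ofReal
          (C * (2 * R) ^ s * Real.exp (((β + ε) - s * Real.log 2) * n))) atTop (𝓝 0) := by
        have h1 : Tendsto (fun n : ℕ => Real.exp (((β + ε) - s * Real.log 2) * n)) atTop (𝓝 0) :=
          Real.tendsto_exp_atBot.comp
            ((tendsto_natCast_atTop_atTop).const_mul_atTop_of_neg hx)
        simpa using ENNReal.tendsto_ofReal (h1.const_mul (C * (2 * R) ^ s))
      refine (liminf_le_liminf (Eventually.of_forall fun n => ?_)).trans_eq hlim.liminf_eq
      calc ∑ x : F n, ediam (closedBall (x : X) (R / 2 ^ n)) ^ s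
          ≤ ∑ x : F n, ENNReal.ofReal ((2 * (R / 2 ^ n)) ^ s) := by
            refine Finset.sum_le_sum fun x _ => ?_
            rw [← ENNReal.ofReal_rpow_of_pos (by positivity)]
            exact ENNReal.rpow_le_rpow (hdiam n x) hs0.le
        _ = ENNReal.ofReal ((F n).card * (2 * (R / 2 ^ n)) ^ s) := by
            rw [Finset.sum_const, Finset.card_univ, Fintype.card_coe, nsmul_eq_mul,
              ENNReal.ofReal_mul (Nat.cast_nonneg _), ENNReal.ofReal_natCast]
        _ ≤ _ := by
            refine ENNReal.ofReal_le_ofReal ?_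
            refine (mul_le_mul_of_nonneg_right (hcard n) (by positivity)).trans_eq ?_
            have e : 2 * (R / 2 ^ n) = (2 * R) * Real.exp (-(Real.log 2 * n)) := by
              rw [Real.exp_neg, mul_comm (Real.log 2), Real.exp_nat_mul,
                Real.exp_log (by norm_num)]
              ring
            rw [e, Real.mul_rpow (by positivity) (Real.exp_nonneg _), ← Real.exp_mul,
              sub_mul, sub_eq_add_neg, Real.exp_add]
            have : -(Real.log 2 * n) * s = -(s * Real.log 2 * n) := by ring
            rw [this]; ring
  have h2 : dimH E ≤ (s.toNNReal : ℝ≥0∞) := by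
    refine dimH_le_of_hausdorffMeasure_ne_top ?_
    rw [Real.coe_toNNReal _ hs0.le, hzero]
    exact ENNReal.zero_ne_top
  refine h2.trans_eq ?_
  change ENNReal.ofReal s = _
  rw [hs, ENNReal.ofReal_add (by positivity) hδ'.le, ENNReal.ofReal_coe_nnreal]

lemma exists_two_pow_bracket {δ : ℝ} (h0 : 0 < δ) (h1 : δ ≤ 1 / 2) :
    ∃ k : ℕ, δ < 1 / 2 ^ k ∧ 1 / 2 ^ k ≤ 4 * δ := by
  have h2 : 1 ≤ 1 / (2 * δ) := by rw [le_div_iff₀ (by positivity)]; linarith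
  obtain ⟨n, hn1, hn2⟩ := exists_nat_pow_near h2 (show (1 : ℝ) < 2 by norm_num)
  rw [le_div_iff₀ (by positivity)] at hn1
  rw [div_lt_iff₀ (by positivity), pow_succ] at hn2
  have hp : (0 : ℝ) < 2 ^ n := by positivity
  refine ⟨n, ?_, ?_⟩
  · rw [lt_div_iff₀ hp]; nlinarith
  · rw [div_le_iff₀ hp]; linarith

lemma le_dimH_of_measure [MeasurableSpace X] [BorelSpace X] {E : Set X} {β : ℝ}
    (h : ∀ ε > 0, ∃ C > 0, ∃ ν : Measure X, 1 ≤ ν E ∧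
      ∀ (k : ℕ) x, ν (ball x (1 / 2 ^ k)) ≤ ENNReal.ofReal (C * Real.exp (-(β - ε) * k))) :
    ENNReal.ofReal (β / Real.log 2) ≤ dimH E := by
  have hl2 : 0 < Real.log 2 := Real.log_pos (by norm_num)
  refine ENNReal.le_of_forall_pos_le_add fun δ hδ _ => ?_
  have hδ' : (0 : ℝ) < δ := hδ
  set s : ℝ := β / Real.log 2 - δ with hs
  rcases le_or_gt s 0 with hs0 | hs0
  · refine le_add_left ?_
    rw [← ENNReal.ofReal_coe_nnreal]
    exact ENNReal.ofReal_le_ofReal (by linarith)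
  obtain ⟨C, hC, ν, hν, hball⟩ := h (δ * Real.log 2) (by positivity)
  have hs' : β - δ * Real.log 2 = s * Real.log 2 := by rw [hs]; field_simp
  have hball' : ∀ (k : ℕ) x, ν (ball x (1 / 2 ^ k)) ≤ ENNReal.ofReal (C * (1 / 2 ^ k) ^ s) := by
    intro k x
    refine (hball k x).trans_eq ?_
    rw [hs']
    have e : (1 : ℝ) / 2 ^ k = Real.exp (-(Real.log 2 * k)) := by
      rw [Real.exp_neg, mul_comm (Real.log 2), Real.exp_nat_mul, Real.exp_log (by norm_num)]
      ring
    rw [e, ← Real.exp_mul]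
    ring_nf
  have key : ∀ t : Set X, ediam t ≤ ENNReal.ofReal (1 / 2) →
      ν t ≤ ENNReal.ofReal (C * 4 ^ s) * ediam t ^ s := by
    intro t ht
    rcases t.eq_empty_or_nonempty with rfl | ⟨x, hx⟩
    · simp
    have hfin : ediam t ≠ ∞ := ne_top_of_le_ne_top ENNReal.ofReal_ne_top ht
    have hdist : ∀ z ∈ t, dist z x ≤ (ediam t).toReal := fun z hz => by
      rw [dist_edist]
      exact ENNReal.toReal_mono hfin (edist_le_ediam_of_mem hz hx)
    have hsub : ∀ r, (ediam t).toReal < r → t ⊆ ball x r := fun r hr z hz =>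
      (hdist z hz).trans_lt hr
    rcases eq_or_ne (ediam t) 0 with h0 | h0
    · rw [h0, ENNReal.zero_rpow_of_pos hs0, mul_zero]
      have hlim : Tendsto (fun k : ℕ => ENNReal.ofReal (C * (1 / 2 ^ k) ^ s)) atTop (𝓝 0) := by
        have h1 : Tendsto (fun k : ℕ => ((1 : ℝ) / 2 ^ k)) atTop (𝓝 0) := by
          have := tendsto_pow_atTop_nhds_zero_of_lt_one (r := (1 / 2 : ℝ)) (by norm_num)
            (by norm_num)
          refine this.congr fun n => ?_
          rw [div_pow, one_pow]
        have h2 := (h1.rpow_const (p := s) (Or.inr hs0.le)).const_mul C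
        rw [Real.zero_rpow hs0.ne', mul_zero] at h2
        simpa using ENNReal.tendsto_ofReal h2
      refine ge_of_tendsto' hlim fun k => (measure_mono (hsub _ ?_)).trans (hball' k x)
      rw [h0]; simp
    · have hpos : 0 < (ediam t).toReal := ENNReal.toReal_pos h0 hfin
      have hlt : (ediam t).toReal ≤ 1 / 2 := by
        have := ENNReal.toReal_mono ENNReal.ofReal_ne_top ht
        rwa [ENNReal.toReal_ofReal (by norm_num)] at this
      obtain ⟨k, hk1, hk2⟩ := exists_two_pow_bracket hpos hlt
      refine ((measure_mono (hsub _ hk1)).trans (hball' k x)).trans ?_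
      have e : ediam t ^ s = ENNReal.ofReal ((ediam t).toReal ^ s) := by
        rw [← ENNReal.ofReal_rpow_of_pos hpos, ENNReal.ofReal_toReal hfin]
      rw [e, ← ENNReal.ofReal_mul (by positivity)]
      refine ENNReal.ofReal_le_ofReal ?_
      rw [mul_assoc, ← Real.mul_rpow (by norm_num) hpos.le]
      gcongr
  set c : ℝ≥0∞ := ENNReal.ofReal (C * 4 ^ s) with hc
  have hc0 : c ≠ 0 := by
    rw [hc]; exact (ENNReal.ofReal_pos.mpr (by positivity)).ne'
  have hct : c ≠ ∞ := ENNReal.ofReal_ne_top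
  have hle : c⁻¹ • ν ≤ μH[s] := by
    refine Measure.le_hausdorffMeasure s _ (ENNReal.ofReal (1 / 2)) (by simp) fun t ht => ?_
    rw [Measure.smul_apply, smul_eq_mul, ENNReal.inv_mul_le_iff hc0 hct]
    exact key t ht
  have hpos : μH[s] E ≠ 0 := by
    have h1 := hle E
    rw [Measure.smul_apply, smul_eq_mul] at h1
    refine (lt_of_lt_of_le (ENNReal.mul_pos ?_ ?_) h1).ne'
    · exact ENNReal.inv_ne_zero.mpr hct
    · exact (lt_of_lt_of_le one_pos hν).ne'
  have h2 : (s.toNNReal : ℝ≥0∞) ≤ dimH E := by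
    refine le_dimH_of_hausdorffMeasure_ne_zero ?_
    rwa [Real.coe_toNNReal _ hs0.le]
  calc ENNReal.ofReal (β / Real.log 2) = ENNReal.ofReal (s + δ) := by rw [hs]; ring_nf
    _ = ENNReal.ofReal s + δ := by
        rw [ENNReal.ofReal_add hs0.le hδ'.le, ENNReal.ofReal_coe_nnreal]
    _ ≤ _ := by gcongr; exact h2

lemma tendsto_coverNum [MeasurableSpace X] {E : Set X} {β R : ℝ} (hβ : 0 ≤ β) (hR : 0 < R)
    (hup : ∀ ε > 0, ∃ C > 0, ∀ n : ℕ, ∃ F : Finset X,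
      (F.card : ℝ) ≤ C * Real.exp ((β + ε) * n) ∧ E ⊆ ⋃ x ∈ F, closedBall x (R / 2 ^ n))
    (hlow : ∀ ε > 0, ∃ C > 0, ∃ ν : Measure X, 1 ≤ ν E ∧
      ∀ (k : ℕ) x, ν (ball x (1 / 2 ^ k)) ≤ ENNReal.ofReal (C * Real.exp (-(β - ε) * k))) :
    Tendsto (fun ε : ℝ => Real.log (coverNum E ε) / Real.log (1 / ε)) (𝓝[>] 0)
      (𝓝 (β / Real.log 2)) := by
  have hl2 : 0 < Real.log 2 := Real.log_pos (by norm_num)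
  have key : ∀ η > 0, ∃ K : ℝ, ∀ r : ℝ, 0 < r → r < 1 →
      |Real.log (coverNum E r) - β / Real.log 2 * Real.log (1 / r)| ≤
        η * Real.log (1 / r) + K := by
    intro η hη
    set ε := η * Real.log 2 with hε
    have hε0 : 0 < ε := by positivity
    obtain ⟨C, hC, hF⟩ := hup ε hε0
    obtain ⟨C', hC', ν, hν, hball⟩ := hlow ε hε0
    refine ⟨max (Real.log C + (β + ε) * (|Real.log R| / Real.log 2 + 2))
      (|β - ε| + Real.log C'), fun r hr0 hr1 => ?_⟩
    set t := Real.log (1 / r) with ht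
    have ht0 : 0 < t := Real.log_pos (by rw [lt_div_iff₀ hr0]; linarith)
    have htr : Real.log r = -t := by rw [ht, one_div, Real.log_inv, neg_neg]
    -- the upper cover
    obtain ⟨n, hn1, hn2⟩ : ∃ n : ℕ, R / 2 ^ n < r ∧
        (n : ℝ) ≤ t / Real.log 2 + (|Real.log R| / Real.log 2 + 2) := by
      refine ⟨⌊(t + |Real.log R|) / Real.log 2⌋₊ + 1, ?_, ?_⟩
      · have h1 := Nat.lt_floor_add_one ((t + |Real.log R|) / Real.log 2)
        rw [div_lt_iff₀ hl2] at h1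
        rw [← Real.log_lt_log_iff (by positivity) hr0, Real.log_div hR.ne' (by positivity),
          Real.log_pow, htr]
        push_cast
        linarith [le_abs_self (Real.log R)]
      · have h1 := Nat.floor_le (show 0 ≤ (t + |Real.log R|) / Real.log 2 by positivity)
        push_cast
        rw [add_div] at h1 ⊢
        linarith
    obtain ⟨F, hFc, hFE⟩ := hF n
    have hsubF : E ⊆ ⋃ x ∈ F, ball x r :=
      hFE.trans (iUnion₂_mono fun x _ => closedBall_subset_ball hn1)
    have hle : coverNum E r ≤ F.card := Nat.sInf_le ⟨F, rfl, hsubF⟩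
    -- an optimal cover
    obtain ⟨G, hGc, hGE⟩ : ∃ G : Finset X, G.card = coverNum E r ∧ E ⊆ ⋃ x ∈ G, ball x r :=
      Nat.sInf_mem (s := {n : ℕ | ∃ F : Finset X, F.card = n ∧ E ⊆ ⋃ x ∈ F, ball x r})
        ⟨F.card, F, rfl, hsubF⟩
    obtain ⟨k, hk1, hk2, hk3⟩ : ∃ k : ℕ, r ≤ 1 / 2 ^ k ∧ (k : ℝ) ≤ t / Real.log 2 ∧
        t / Real.log 2 ≤ k + 1 := by
      have h1 := Nat.floor_le (show 0 ≤ t / Real.log 2 by positivity)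
      refine ⟨⌊t / Real.log 2⌋₊, ?_, h1, (Nat.lt_floor_add_one _).le⟩
      rw [← Real.log_le_log_iff hr0 (by positivity), one_div, Real.log_inv, Real.log_pow, htr]
      rw [le_div_iff₀ hl2] at h1
      linarith
    have hN : 1 ≤ (coverNum E r : ℝ) * (C' * Real.exp (-(β - ε) * k)) := by
      have h1 : (1 : ℝ≥0∞) ≤ ENNReal.ofReal
          ((coverNum E r : ℝ) * (C' * Real.exp (-(β - ε) * k))) := by
        calc (1 : ℝ≥0∞) ≤ ν E := hν
          _ ≤ ν (⋃ x ∈ G, ball x r) := measure_mono hGE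
          _ ≤ ∑ x ∈ G, ν (ball x r) := measure_biUnion_finset_le _ _
          _ ≤ ∑ x ∈ G, ENNReal.ofReal (C' * Real.exp (-(β - ε) * k)) :=
            Finset.sum_le_sum fun x _ => (measure_mono (ball_subset_ball hk1)).trans (hball k x)
          _ = _ := by
            rw [Finset.sum_const, hGc, nsmul_eq_mul, ENNReal.ofReal_mul (Nat.cast_nonneg _),
              ENNReal.ofReal_natCast]
      rwa [ENNReal.one_le_ofReal] at h1
    have hN0 : (0 : ℝ) < coverNum E r := by
      refine lt_of_le_of_ne (Nat.cast_nonneg _) fun h0 => ?_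
      rw [← h0, zero_mul] at hN
      linarith
    have hlogN : 0 ≤ Real.log (coverNum E r) + (Real.log C' + -(β - ε) * k) := by
      have := Real.log_nonneg hN
      rwa [Real.log_mul hN0.ne' (by positivity), Real.log_mul hC'.ne' (by positivity),
        Real.log_exp] at this
    have hlogN' : Real.log (coverNum E r) ≤ Real.log C + (β + ε) * n := by
      have := Real.log_le_log hN0 ((Nat.cast_le.mpr hle).trans hFc)
      rwa [Real.log_mul hC.ne' (by positivity), Real.log_exp] at this
    have e1 : (β + ε) * (t / Real.log 2) = β / Real.log 2 * t + η * t := by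
      rw [hε]; field_simp
    have e2 : (β - ε) * (t / Real.log 2) = β / Real.log 2 * t - η * t := by
      rw [hε]; field_simp
    have h3 : (β + ε) * n ≤ (β + ε) * (t / Real.log 2 + (|Real.log R| / Real.log 2 + 2)) :=
      mul_le_mul_of_nonneg_left hn2 (by positivity)
    have h4 : (β - ε) * (t / Real.log 2) - (β - ε) * k ≤ |β - ε| := by
      rw [← mul_sub]
      calc (β - ε) * (t / Real.log 2 - k) ≤ |β - ε| * (t / Real.log 2 - k) :=
            mul_le_mul_of_nonneg_right (le_abs_self _) (by linarith)
        _ ≤ |β - ε| * 1 := mul_le_mul_of_nonneg_left (by linarith) (abs_nonneg _)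
        _ = _ := mul_one _
    rw [mul_add] at h3
    rw [abs_le]
    constructor
    · have := le_max_right (Real.log C + (β + ε) * (|Real.log R| / Real.log 2 + 2))
        (|β - ε| + Real.log C')
      linarith
    · have := le_max_left (Real.log C + (β + ε) * (|Real.log R| / Real.log 2 + 2))
        (|β - ε| + Real.log C')
      linarith
  have hlog : Tendsto (fun r : ℝ => Real.log (1 / r)) (𝓝[>] 0) atTop := by
    simp only [one_div, Real.log_inv]
    exact tendsto_neg_atBot_atTop.comp Real.tendsto_log_nhdsGT_zero
  rw [Metric.tendsto_nhds]
  intro η hη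
  obtain ⟨K, hK⟩ := key (η / 2) (by positivity)
  filter_upwards [hlog.eventually_gt_atTop (max 0 (K / (η / 2))),
    Ioo_mem_nhdsGT (show (0 : ℝ) < 1 by norm_num)] with r hr1 hr2
  have ht0 : 0 < Real.log (1 / r) := (le_max_left _ _).trans_lt hr1
  have ht1 : K < Real.log (1 / r) * (η / 2) := by
    rw [← div_lt_iff₀ (by positivity)]
    exact (le_max_right _ _).trans_lt hr1
  have := hK r hr2.1 hr2.2
  rw [Real.dist_eq]
  have e : Real.log (coverNum E r) / Real.log (1 / r) - β / Real.log 2 =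
      (Real.log (coverNum E r) - β / Real.log 2 * Real.log (1 / r)) / Real.log (1 / r) := by
    field_simp
  rw [e, abs_div, abs_of_pos ht0, div_lt_iff₀ ht0]
  linarith

end Dimensions

/-- A coordinate function on the gasket, normalized so that the maps of the iterated function
system act on it by `t ↦ (t + d i) / 2`. -/
structure IsGasketHeight (f : ℝ × ℝ → ℝ) (d : Fin 3 → ℕ) : Prop where
  continuous : Continuous f
  zero : f 0 = 0
  map : ∀ i z, f (gasketMap i z) = (f z + d i) / 2

section Gasket

variable {d : Fin 3 → ℕ} {M : ℕ} {Δ : Set (ℝ × ℝ)} {f : ℝ × ℝ → ℝ}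

lemma continuous_gasketMap (i : Fin 3) : Continuous (gasketMap i) := by
  fin_cases i <;> simp only [gasketMap] <;> fun_prop

lemma dist_gasketMap (i : Fin 3) (z w : ℝ × ℝ) :
    dist (gasketMap i z) (gasketMap i w) = dist z w / 2 := by
  have h : ∀ a b c : ℝ, dist (a / 2 + c) (b / 2 + c) = dist a b / 2 := fun a b c => by
    rw [Real.dist_eq, Real.dist_eq, add_sub_add_right_eq_sub, ← sub_div, abs_div, abs_two]
  have h' : ∀ a b : ℝ, dist (a / 2) (b / 2) = dist a b / 2 := fun a b => by
    simpa using h a b 0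
  fin_cases i <;> simp [gasketMap, Prod.dist_eq, h, h', max_div_div_right]

lemma IsSierpinskiGasket.map_mem (hΔ : IsSierpinskiGasket Δ) (i : Fin 3) {z : ℝ × ℝ}
    (hz : z ∈ Δ) : gasketMap i z ∈ Δ := by
  rw [hΔ.2.2]
  fin_cases i
  · exact Or.inl (Or.inl ⟨z, hz, rfl⟩)
  · exact Or.inl (Or.inr ⟨z, hz, rfl⟩)
  · exact Or.inr ⟨z, hz, rfl⟩

lemma IsSierpinskiGasket.exists_preimage (hΔ : IsSierpinskiGasket Δ) {z : ℝ × ℝ}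
    (hz : z ∈ Δ) : ∃ i, ∃ w ∈ Δ, gasketMap i w = z := by
  rw [hΔ.2.2] at hz
  rcases hz with (hz | hz) | hz
  exacts [⟨0, hz⟩, ⟨1, hz⟩, ⟨2, hz⟩]

lemma IsSierpinskiGasket.zero_mem (hΔ : IsSierpinskiGasket Δ) : (0 : ℝ × ℝ) ∈ Δ := by
  obtain ⟨z, hz⟩ := hΔ.1
  have h1 : ∀ n, (gasketMap 0)^[n] z ∈ Δ := fun n => by
    induction n with
    | zero => exact hz
    | succ n ih => rw [Function.iterate_succ_apply']; exact hΔ.map_mem 0 ih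
  have h2 : ∀ n, (gasketMap 0)^[n] z = ((1 / 2 : ℝ) ^ n * z.1, (1 / 2 : ℝ) ^ n * z.2) := fun n => by
    induction n with
    | zero => simp
    | succ n ih =>
      rw [Function.iterate_succ_apply', ih]
      simp only [gasketMap, pow_succ]
      ext <;> simp <;> ring
  have h3 : Tendsto (fun n : ℕ => (1 / 2 : ℝ) ^ n) atTop (𝓝 0) :=
    tendsto_pow_atTop_nhds_zero_of_lt_one (by norm_num) (by norm_num)
  have h4 : Tendsto (fun n : ℕ => (gasketMap 0)^[n] z) atTop (𝓝 0) := by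
    simp only [h2]
    have := (h3.mul_const z.1).prodMk_nhds (h3.mul_const z.2)
    rwa [zero_mul, zero_mul] at this
  exact hΔ.2.1.isClosed.mem_of_tendsto h4 (Eventually.of_forall h1)

lemma IsGasketHeight.mem_Icc (hf : IsGasketHeight f d) (hd : IsDigitSystem d M)
    (hΔ : IsSierpinskiGasket Δ) {z : ℝ × ℝ} (hz : z ∈ Δ) : f z ∈ Icc (0 : ℝ) M := by
  have hM : ∀ i, (d i : ℝ) ≤ M := fun i => Nat.cast_le.mpr (hd.le i)
  constructor
  · obtain ⟨w, hw, hmin⟩ := hΔ.2.1.exists_isMinOn hΔ.1 hf.continuous.continuousOn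
    obtain ⟨i, v, hv, rfl⟩ := hΔ.exists_preimage hw
    have h1 := isMinOn_iff.mp hmin v hv
    have h2 := isMinOn_iff.mp hmin z hz
    rw [hf.map] at h1 h2
    have : (0 : ℝ) ≤ d i := Nat.cast_nonneg _
    linarith
  · obtain ⟨w, hw, hmax⟩ := hΔ.2.1.exists_isMaxOn hΔ.1 hf.continuous.continuousOn
    obtain ⟨i, v, hv, rfl⟩ := hΔ.exists_preimage hw
    have h1 := isMaxOn_iff.mp hmax v hv
    have h2 := isMaxOn_iff.mp hmax z hz
    rw [hf.map] at h1 h2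
    have := hM i
    linarith

lemma exists_slice_cover (hf : IsGasketHeight f d) (hd : IsDigitSystem d M)
    (hΔ : IsSierpinskiGasket Δ) {R : ℝ} (hR : Δ ⊆ closedBall 0 R) (n : ℕ) {y : ℝ}
    (hy : ∀ (n : ℕ) (m : ℤ), 2 ^ n * y ≠ m) :
    ∃ F : Finset (ℝ × ℝ), (F.card : ℝ) ≤ cylCount d M n y ∧
      {z ∈ Δ | f z = y} ⊆ ⋃ x ∈ F, closedBall x (R / 2 ^ n) := by
  induction n generalizing y with
  | zero =>
    by_cases h : 0 ≤ y ∧ y < M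
    · refine ⟨{0}, by simp [cylCount, transferOp, baseInd, h], fun z hz => ?_⟩
      simpa using hR hz.1
    · refine ⟨∅, cylCount_nonneg _ _ |>.trans' (by simp), fun z hz => (h ?_).elim⟩
      have h1 := hf.mem_Icc hd hΔ hz.1
      rw [hz.2] at h1
      exact ⟨h1.1, lt_of_le_of_ne h1.2 fun e => hy 0 M (by simpa using e)⟩
  | succ n ih =>
    have hy' : ∀ (i : Fin 3) (k : ℕ) (m : ℤ), 2 ^ k * (2 * y - d i) ≠ m := fun i k m e => by
      refine hy (k + 1) (m + 2 ^ k * d i) ?_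
      push_cast
      rw [← e]; ring
    choose F hFc hF using fun i => ih (hy' i)
    refine ⟨Finset.univ.biUnion fun i => (F i).image (gasketMap i), ?_, fun z hz => ?_⟩
    · rw [cylCount_succ]
      calc ((Finset.univ.biUnion fun i => (F i).image (gasketMap i)).card : ℝ)
          ≤ ((∑ i, (F i).card : ℕ) : ℝ) :=
            Nat.cast_le.mpr (Finset.card_biUnion_le.trans
              (Finset.sum_le_sum fun i _ => Finset.card_image_le))
        _ ≤ _ := by push_cast; exact Finset.sum_le_sum fun i _ => hFc i
    · obtain ⟨i, w, hw, rfl⟩ := hΔ.exists_preimage hz.1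
      have h1 : f w = 2 * y - d i := by
        have := hz.2
        rw [hf.map] at this
        linarith
      obtain ⟨x, hx, hxw⟩ := mem_iUnion₂.mp (hF i ⟨hw, h1⟩)
      refine mem_iUnion₂.mpr ⟨gasketMap i x, ?_, ?_⟩
      · exact Finset.mem_biUnion.mpr ⟨i, Finset.mem_univ _, Finset.mem_image_of_mem _ hx⟩
      · rw [mem_closedBall] at hxw ⊢
        rw [dist_gasketMap, pow_succ, ← div_div]
        linarith

/-- The finite-stage mass distributions on the slice at height `y`. -/
def sliceMeas (d : Fin 3 → ℕ) (M : ℕ) : ℕ → ℝ → Measure (ℝ × ℝ)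
  | 0, y => ENNReal.ofReal (baseInd M y) • Measure.dirac 0
  | n + 1, y => ∑ i, (sliceMeas d M n (2 * y - d i)).map (gasketMap i)

lemma sliceMeas_succ_apply (n : ℕ) (y : ℝ) {s : Set (ℝ × ℝ)} (hs : MeasurableSet s) :
    sliceMeas d M (n + 1) y s = ∑ i, sliceMeas d M n (2 * y - d i) (gasketMap i ⁻¹' s) := by
  simp only [sliceMeas, Measure.finsetSum_apply]
  exact Finset.sum_congr rfl fun i _ => Measure.map_apply (continuous_gasketMap i).measurable hs

lemma sliceMeas_univ (n : ℕ) (y : ℝ) :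
    sliceMeas d M n y univ = ENNReal.ofReal (cylCount d M n y) := by
  induction n generalizing y with
  | zero => simp [sliceMeas, cylCount, transferOp]
  | succ n ih =>
    rw [sliceMeas_succ_apply n y MeasurableSet.univ, cylCount_succ,
      ENNReal.ofReal_sum_of_nonneg fun i _ => cylCount_nonneg _ _]
    simp only [preimage_univ, ih]

lemma sliceMeas_compl_eq_zero (hf : IsGasketHeight f d) (hΔ : IsSierpinskiGasket Δ)
    (n : ℕ) (y : ℝ) : sliceMeas d M n y {z ∈ Δ | |f z - y| ≤ M / 2 ^ n}ᶜ = 0 := by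
  have hm : ∀ (n : ℕ) (y : ℝ), MeasurableSet {z ∈ Δ | |f z - y| ≤ M / 2 ^ n} := fun n y =>
    (hΔ.2.1.isClosed.inter
      (isClosed_le (hf.continuous.sub continuous_const).abs continuous_const)).measurableSet
  induction n generalizing y with
  | zero =>
    simp only [sliceMeas, Measure.smul_apply, smul_eq_mul, mul_eq_zero]
    by_cases h : 0 ≤ y ∧ y < M
    · right
      rw [Measure.dirac_apply' _ (hm 0 y).compl, indicator_of_notMem]
      rw [notMem_compl_iff]
      refine ⟨hΔ.zero_mem, ?_⟩
      rw [hf.zero, zero_sub, abs_neg, abs_of_nonneg h.1, pow_zero, div_one]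
      exact h.2.le
    · left; simp [baseInd, h]
  | succ n ih =>
    rw [sliceMeas_succ_apply n y (hm _ _).compl]
    refine Finset.sum_eq_zero fun i _ => measure_mono_null (fun w hw => ?_) (ih (2 * y - d i))
    rw [mem_preimage, mem_compl_iff] at hw
    rw [mem_compl_iff]
    refine fun h => hw ⟨hΔ.map_mem i h.1, ?_⟩
    have e : f (gasketMap i w) - y = (f w - (2 * y - d i)) / 2 := by rw [hf.map]; ring
    rw [e, abs_div, abs_two, pow_succ, ← div_div]
    linarith [h.2]

/-- The first oblique coordinate, in which the gasket maps become translated halvings. -/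
def obliqueFst (z : ℝ × ℝ) : ℝ := z.1 - z.2 / Real.sqrt 3

/-- The second oblique coordinate. -/
def obliqueSnd (z : ℝ × ℝ) : ℝ := 2 * z.2 / Real.sqrt 3

/-- The vertices of the gasket in oblique coordinates. -/
def obliqueVertex : Fin 3 → ℤ × ℤ
  | 0 => (0, 0)
  | 1 => (1, 0)
  | 2 => (0, 1)

lemma obliqueFst_gasketMap (i : Fin 3) (z : ℝ × ℝ) :
    obliqueFst (gasketMap i z) = (obliqueFst z + (obliqueVertex i).1) / 2 := by
  have h3 : Real.sqrt 3 ≠ 0 := by positivity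
  fin_cases i <;> simp [gasketMap, obliqueFst, obliqueVertex] <;> field_simp <;> ring

lemma obliqueSnd_gasketMap (i : Fin 3) (z : ℝ × ℝ) :
    obliqueSnd (gasketMap i z) = (obliqueSnd z + (obliqueVertex i).2) / 2 := by
  have h3 : Real.sqrt 3 ≠ 0 := by positivity
  fin_cases i <;> simp [gasketMap, obliqueSnd, obliqueVertex] <;> field_simp; ring

/-- The dyadic oblique square of generation `k` with index `P`. -/
def obliqueSquare (k : ℕ) (P : ℤ × ℤ) : Set (ℝ × ℝ) :=
  {z | ⌊2 ^ k * obliqueFst z⌋ = P.1 ∧ ⌊2 ^ k * obliqueSnd z⌋ = P.2}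

lemma continuous_obliqueFst : Continuous obliqueFst := by unfold obliqueFst; fun_prop

lemma continuous_obliqueSnd : Continuous obliqueSnd := by unfold obliqueSnd; fun_prop

lemma measurableSet_obliqueSquare (k : ℕ) (P : ℤ × ℤ) : MeasurableSet (obliqueSquare k P) := by
  have h1 : Measurable fun z => ⌊2 ^ k * obliqueFst z⌋ :=
    (continuous_obliqueFst.measurable.const_mul _).floor
  have h2 : Measurable fun z => ⌊2 ^ k * obliqueSnd z⌋ :=
    (continuous_obliqueSnd.measurable.const_mul _).floor
  exact (h1 (measurableSet_singleton P.1)).inter (h2 (measurableSet_singleton P.2))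

lemma preimage_obliqueSquare (i : Fin 3) (k : ℕ) (P : ℤ × ℤ) :
    gasketMap i ⁻¹' obliqueSquare (k + 1) P =
      obliqueSquare k (P.1 - 2 ^ k * (obliqueVertex i).1, P.2 - 2 ^ k * (obliqueVertex i).2) := by
  have h : ∀ (u : ℝ) (e m : ℤ), ⌊2 ^ (k + 1) * ((u + e) / 2)⌋ = m ↔
      ⌊2 ^ k * u⌋ = m - 2 ^ k * e := fun u e m => by
    have : (2 : ℝ) ^ (k + 1) * ((u + e) / 2) = 2 ^ k * u + ((2 ^ k * e : ℤ) : ℝ) := by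
      push_cast; ring
    rw [this, Int.floor_add_intCast]
    constructor <;> intro h <;> linarith
  ext z
  simp only [obliqueSquare, mem_preimage, mem_ofPred_eq, obliqueFst_gasketMap,
    obliqueSnd_gasketMap, h]

lemma preimage_obliqueSquare_zero (i : Fin 3) (z : ℝ × ℝ) (hz : z ∈ obliqueSquare 0 0) :
    gasketMap i z ∈ obliqueSquare 0 0 := by
  simp only [obliqueSquare, mem_ofPred_eq, pow_zero, one_mul, Prod.fst_zero, Prod.snd_zero,
    Int.floor_eq_zero_iff, mem_Ico, obliqueFst_gasketMap, obliqueSnd_gasketMap] at hz ⊢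
  have h : (obliqueVertex i).1 ∈ Icc (0 : ℤ) 1 ∧ (obliqueVertex i).2 ∈ Icc (0 : ℤ) 1 := by
    fin_cases i <;> simp [obliqueVertex]
  have h1 : (0 : ℝ) ≤ (obliqueVertex i).1 := Int.cast_nonneg h.1.1
  have h2 : ((obliqueVertex i).1 : ℝ) ≤ 1 := mod_cast h.1.2
  have h3 : (0 : ℝ) ≤ (obliqueVertex i).2 := Int.cast_nonneg h.2.1
  have h4 : ((obliqueVertex i).2 : ℝ) ≤ 1 := mod_cast h.2.2
  obtain ⟨⟨h5, h6⟩, h7, h8⟩ := hz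
  refine ⟨⟨?_, ?_⟩, ?_, ?_⟩ <;> linarith

lemma sliceMeas_compl_obliqueSquare (n : ℕ) (y : ℝ) :
    sliceMeas d M n y (obliqueSquare 0 0)ᶜ = 0 := by
  have hm := (measurableSet_obliqueSquare 0 0).compl
  induction n generalizing y with
  | zero =>
    have : (0 : ℝ × ℝ) ∈ obliqueSquare 0 0 := by simp [obliqueSquare, obliqueFst, obliqueSnd]
    simp [sliceMeas, Measure.dirac_apply' _ hm, this]
  | succ n ih =>
    rw [sliceMeas_succ_apply n y hm]
    exact Finset.sum_eq_zero fun i _ => measure_mono_null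
      (fun w hw h => hw (preimage_obliqueSquare_zero i w h)) (ih _)

lemma ediv_two_pow_eq_zero_of_mem {k : ℕ} {P : ℤ × ℤ} {z : ℝ × ℝ} (hz : z ∈ obliqueSquare k P)
    (hz0 : z ∈ obliqueSquare 0 0) : P.1 / 2 ^ k = 0 ∧ P.2 / 2 ^ k = 0 := by
  have h : ∀ (u : ℝ) (m : ℤ), ⌊2 ^ k * u⌋ = m → ⌊u⌋ = 0 → m / 2 ^ k = 0 := by
    rintro u m rfl hu
    rw [Int.floor_eq_zero_iff, mem_Ico] at hu
    have hp : (0 : ℝ) < 2 ^ k := by positivity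
    refine Int.ediv_eq_zero_of_lt (Int.floor_nonneg.mpr (mul_nonneg hp.le hu.1)) ?_
    rw [Int.floor_lt]
    push_cast
    nlinarith [hu.2]
  simp only [obliqueSquare, mem_ofPred_eq, pow_zero, one_mul, Prod.fst_zero, Prod.snd_zero]
    at hz hz0
  exact ⟨h _ _ hz.1 hz0.1, h _ _ hz.2 hz0.2⟩

lemma sliceMeas_obliqueSquare_le (hd : IsDigitSystem d M) (n k : ℕ) (y : ℝ) (P : ℤ × ℤ) :
    sliceMeas d M (n + k) y (obliqueSquare k P) ≤
      ENNReal.ofReal (fiberSum d M n (2 ^ k * y)) := by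
  induction k generalizing y P with
  | zero =>
    refine (measure_mono (subset_univ _)).trans ?_
    rw [sliceMeas_univ, pow_zero, one_mul, add_zero]
    exact ENNReal.ofReal_le_ofReal (cylCount_le_fiberSum hd n y)
  | succ k ih =>
    rw [← add_assoc, sliceMeas_succ_apply _ _ (measurableSet_obliqueSquare _ _)]
    simp only [preimage_obliqueSquare]
    have hzero : ∀ i, (P.1 / 2 ^ k, P.2 / 2 ^ k) ≠ obliqueVertex i →
        sliceMeas d M (n + k) (2 * y - d i) (obliqueSquare k
          (P.1 - 2 ^ k * (obliqueVertex i).1, P.2 - 2 ^ k * (obliqueVertex i).2)) = 0 := by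
      intro i hi
      refine measure_mono_null (t := (obliqueSquare 0 0)ᶜ) (fun z hz hz0 => hi ?_)
        (sliceMeas_compl_obliqueSquare _ _)
      obtain ⟨h1, h2⟩ := ediv_two_pow_eq_zero_of_mem hz hz0
      have hp : (2 : ℤ) ^ k ≠ 0 := by positivity
      simp only at h1 h2
      rw [sub_eq_add_neg, ← mul_neg, Int.add_mul_ediv_left _ _ hp] at h1 h2
      ext <;> simp only <;> linarith
    by_cases hex : ∃ i, (P.1 / 2 ^ k, P.2 / 2 ^ k) = obliqueVertex i
    · obtain ⟨i, hi⟩ := hex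
      have hinj : Function.Injective obliqueVertex := by
        intro a b hab
        fin_cases a <;> fin_cases b <;> simp_all [obliqueVertex]
      rw [Finset.sum_eq_single i (fun j _ hj => hzero j fun h => hj (hinj (h.symm.trans hi)))
        (fun h => (h (Finset.mem_univ _)).elim)]
      refine (ih _ _).trans_eq ?_
      have e : 2 ^ k * (2 * y - d i) = 2 ^ (k + 1) * y + ((-(2 ^ k * d i) : ℤ) : ℝ) := by
        push_cast; ring
      rw [e, fiberSum_add_int]
    · push Not at hex
      rw [Finset.sum_eq_zero fun i _ => hzero i (hex i)]
      exact bot_le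

lemma abs_floor_sub_floor_le {u v : ℝ} (h : |u - v| < 2) : ⌊u⌋ - ⌊v⌋ ∈ Finset.Icc (-2 : ℤ) 2 := by
  rw [abs_lt] at h
  rw [Finset.mem_Icc]
  have h1 := Int.floor_le u
  have h2 := Int.lt_floor_add_one u
  have h3 := Int.floor_le v
  have h4 := Int.lt_floor_add_one v
  constructor
  · have : ((-3 : ℤ) : ℝ) < ((⌊u⌋ - ⌊v⌋ : ℤ) : ℝ) := by push_cast; linarith
    have := Int.cast_lt.mp this
    omega
  · have : ((⌊u⌋ - ⌊v⌋ : ℤ) : ℝ) < ((3 : ℤ) : ℝ) := by push_cast; linarith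
    have := Int.cast_lt.mp this
    omega

lemma sliceMeas_ball_le (hd : IsDigitSystem d M) (n k : ℕ) (y : ℝ) (x : ℝ × ℝ) :
    sliceMeas d M (n + k) y (ball x (1 / 2 ^ k)) ≤
      ENNReal.ofReal (25 * fiberSum d M n (2 ^ k * y)) := by
  set I : Finset (ℤ × ℤ) := Finset.Icc (-2 : ℤ) 2 ×ˢ Finset.Icc (-2 : ℤ) 2 with hI
  have hsub : ball x (1 / 2 ^ k) ⊆ ⋃ Q ∈ I, obliqueSquare k
      (⌊2 ^ k * obliqueFst x⌋ + Q.1, ⌊2 ^ k * obliqueSnd x⌋ + Q.2) := by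
    intro z hz
    rw [mem_ball, Prod.dist_eq, max_lt_iff, Real.dist_eq, Real.dist_eq, lt_div_iff₀ (by positivity),
      lt_div_iff₀ (by positivity)] at hz
    have hp : (0 : ℝ) < 2 ^ k := by positivity
    have h3 : 1 < Real.sqrt 3 := by rw [Real.lt_sqrt] <;> norm_num
    have h3' : 0 < Real.sqrt 3 := by positivity
    have hq : |(z.2 - x.2) / Real.sqrt 3| * 2 ^ k < 1 := by
      rw [abs_div, abs_of_pos h3', div_mul_eq_mul_div, div_lt_one h3']
      linarith
    have hu : |2 ^ k * obliqueFst z - 2 ^ k * obliqueFst x| < 2 := by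
      have e : 2 ^ k * obliqueFst z - 2 ^ k * obliqueFst x =
          ((z.1 - x.1) - (z.2 - x.2) / Real.sqrt 3) * 2 ^ k := by unfold obliqueFst; ring
      rw [e, abs_mul, abs_of_pos hp]
      have := mul_le_mul_of_nonneg_right (abs_sub (z.1 - x.1) ((z.2 - x.2) / Real.sqrt 3)) hp.le
      linarith
    have hv : |2 ^ k * obliqueSnd z - 2 ^ k * obliqueSnd x| < 2 := by
      have e : 2 ^ k * obliqueSnd z - 2 ^ k * obliqueSnd x =
          2 * (((z.2 - x.2) / Real.sqrt 3) * 2 ^ k) := by unfold obliqueSnd; ring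
      rw [e, abs_mul, abs_two, abs_mul, abs_of_pos hp]
      linarith
    refine mem_iUnion₂.mpr ⟨(⌊2 ^ k * obliqueFst z⌋ - ⌊2 ^ k * obliqueFst x⌋,
      ⌊2 ^ k * obliqueSnd z⌋ - ⌊2 ^ k * obliqueSnd x⌋), ?_, ?_⟩
    · exact Finset.mem_product.mpr ⟨abs_floor_sub_floor_le hu, abs_floor_sub_floor_le hv⟩
    · simp [obliqueSquare]
  calc sliceMeas d M (n + k) y (ball x (1 / 2 ^ k))
      ≤ ∑ Q ∈ I, sliceMeas d M (n + k) y (obliqueSquare k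
        (⌊2 ^ k * obliqueFst x⌋ + Q.1, ⌊2 ^ k * obliqueSnd x⌋ + Q.2)) :=
        (measure_mono hsub).trans (measure_biUnion_finset_le _ _)
    _ ≤ ∑ Q ∈ I, ENNReal.ofReal (fiberSum d M n (2 ^ k * y)) :=
        Finset.sum_le_sum fun Q _ => sliceMeas_obliqueSquare_le hd n k y _
    _ = _ := by
        have : I.card = 25 := rfl
        rw [Finset.sum_const, this, nsmul_eq_mul, ENNReal.ofReal_mul (by norm_num)]
        norm_num

end Gasket

section Slices

variable {d : Fin 3 → ℕ} {M : ℕ} {Δ : Set (ℝ × ℝ)} {f : ℝ × ℝ → ℝ}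

lemma exists_ultrafilter_tendsto {K : Set (ℝ × ℝ)} (hK : IsCompact K)
    (μ : ℕ → ProbabilityMeasure (ℝ × ℝ)) (hμ : ∀ n, (μ n : Measure (ℝ × ℝ)) Kᶜ = 0) :
    ∃ L : Ultrafilter ℕ, (L : Filter ℕ) ≤ atTop ∧ ∃ ν : ProbabilityMeasure (ℝ × ℝ),
      Tendsto μ L (𝓝 ν) := by
  have hc := isCompact_setOfPred_probabilityMeasure_mass_eq_compl_isCompact_le
    (E := ℝ × ℝ) (u := fun _ => 0) (K := fun _ => K) tendsto_const_nhds (fun _ => hK)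
    (Or.inl inferInstance)
  obtain ⟨ν, -, hν⟩ := isCompact_iff_ultrafilter_le_nhds.mp hc ((hyperfilter ℕ).map μ) (by
    rw [le_principal_iff]
    refine Filter.mem_map.mpr (Filter.mem_of_superset Filter.univ_mem fun n _ m => le_of_eq ?_)
    rw [ProbabilityMeasure.null_iff_toMeasure_null]
    exact hμ n)
  exact ⟨hyperfilter ℕ, by simpa using Nat.hyperfilter_le_atTop, ν, hν⟩

lemma exists_slice_measure (hf : IsGasketHeight f d) (hd : IsDigitSystem d M)
    (hΔ : IsSierpinskiGasket Δ) {y C ε : ℝ} (h0 : 0 ≤ y) (hM : y < M) (hC0 : 0 < C)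
    (hC : ∀ k n : ℕ, fiberSum d M n (2 ^ k * y) ≤
      C * Real.exp (ε * k) * fiberMin d M n (2 ^ k * y)) :
    ∃ ν : Measure (ℝ × ℝ), 1 ≤ ν {z ∈ Δ | f z = y} ∧ ∀ (k : ℕ) x, ν (ball x (1 / 2 ^ k)) ≤
      ENNReal.ofReal (25 * (C * Real.exp (ε * k)) / cylCount d M k y) := by
  have hcyl : ∀ n, 0 < cylCount d M n y := fun n =>
    one_pos.trans_le (one_le_cylCount hd n h0 hM)
  set ρ : ℕ → Measure (ℝ × ℝ) := fun n =>
    (ENNReal.ofReal (cylCount d M n y))⁻¹ • sliceMeas d M n y with hρ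
  have hprob : ∀ n, IsProbabilityMeasure (ρ n) := fun n => ⟨by
    rw [hρ, Measure.smul_apply, sliceMeas_univ, smul_eq_mul, ENNReal.inv_mul_cancel
      (ENNReal.ofReal_pos.mpr (hcyl n)).ne' ENNReal.ofReal_ne_top]⟩
  set A : ℕ → Set (ℝ × ℝ) := fun n => {z ∈ Δ | |f z - y| ≤ M / 2 ^ n} with hA
  have hAc : ∀ n, IsClosed (A n) := fun n => hΔ.2.1.isClosed.inter
    (isClosed_le (hf.continuous.sub continuous_const).abs continuous_const)
  have hanti : ∀ m n, m ≤ n → A n ⊆ A m := fun m n hmn z hz => by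
    refine ⟨hz.1, hz.2.trans ?_⟩
    gcongr
    norm_num
  have hρA : ∀ n, ρ n (A n)ᶜ = 0 := fun n => by
    rw [hρ, Measure.smul_apply, sliceMeas_compl_eq_zero hf hΔ, smul_zero]
  obtain ⟨L, hL, ν, hν⟩ := exists_ultrafilter_tendsto hΔ.2.1 (fun n => ⟨ρ n, hprob n⟩)
    fun n => measure_mono_null (compl_subset_compl.mpr fun z hz => hz.1) (hρA n)
  refine ⟨ν, ?_, fun k x => ?_⟩
  · have h1 : ∀ m, (ν : Measure (ℝ × ℝ)) (A m)ᶜ = 0 := fun m => by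
      refine le_antisymm ((ProbabilityMeasure.le_liminf_measure_open_of_tendsto hν
        (hAc m).isOpen_compl).trans ?_) bot_le
      have hev : ∀ᶠ n in (L : Filter ℕ), ρ n (A m)ᶜ = 0 := by
        filter_upwards [hL (eventually_ge_atTop m)] with n hn
        exact measure_mono_null (compl_subset_compl.mpr (hanti m n hn)) (hρA n)
      exact (tendsto_const_nhds.congr' (hev.mono fun n hn => hn.symm)).liminf_eq.le
    have h2 : (⋃ m, (A m)ᶜ) = {z ∈ Δ | f z = y}ᶜ := by
      rw [← compl_iInter]
      congr 1
      ext z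
      rw [mem_iInter]
      refine ⟨fun h => ⟨(h 0).1, ?_⟩, fun h m => ⟨h.1, ?_⟩⟩
      · have hlim : Tendsto (fun m : ℕ => (M : ℝ) / 2 ^ m) atTop (𝓝 0) :=
          tendsto_const_nhds.div_atTop (tendsto_pow_atTop_atTop_of_one_lt (by norm_num))
        have := ge_of_tendsto' hlim fun m => (h m).2
        exact sub_eq_zero.mp (abs_eq_zero.mp (le_antisymm this (abs_nonneg _)))
      · rw [h.2, sub_self, abs_zero]; positivity
    have h3 : (ν : Measure (ℝ × ℝ)) {z ∈ Δ | f z = y}ᶜ = 0 := by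
      rw [← h2]; exact measure_iUnion_null h1
    have hE : MeasurableSet {z ∈ Δ | f z = y} :=
      (hΔ.2.1.isClosed.inter (isClosed_eq hf.continuous continuous_const)).measurableSet
    exact ((prob_compl_eq_zero_iff hE).mp h3).ge
  · refine (ProbabilityMeasure.le_liminf_measure_open_of_tendsto hν isOpen_ball).trans ?_
    refine liminf_le_of_frequently_le' (Eventually.frequently ?_)
    filter_upwards [hL (eventually_ge_atTop k)] with n hn
    obtain ⟨m, rfl⟩ := Nat.exists_eq_add_of_le' hn
    change ρ (m + k) (ball x (1 / 2 ^ k)) ≤ _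
    rw [hρ, Measure.smul_apply, smul_eq_mul,
      ENNReal.inv_mul_le_iff (ENNReal.ofReal_pos.mpr (hcyl _)).ne' ENNReal.ofReal_ne_top]
    refine (sliceMeas_ball_le hd m k y x).trans ?_
    rw [← ENNReal.ofReal_mul (hcyl _).le]
    refine ENNReal.ofReal_le_ofReal ?_
    have h1 := le_cylCount_add (d := d) (M := M) k m y
    rw [add_comm k m] at h1
    have h2 := hC k m
    rw [mul_div_assoc', le_div_iff₀ (hcyl k)]
    calc 25 * fiberSum d M m (2 ^ k * y) * cylCount d M k y
        ≤ 25 * (C * Real.exp (ε * k) * fiberMin d M m (2 ^ k * y)) * cylCount d M k y := by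
          have := (hcyl k).le
          gcongr
      _ = (25 * (C * Real.exp (ε * k))) *
          (cylCount d M k y * fiberMin d M m (2 ^ k * y)) := by ring
      _ ≤ (25 * (C * Real.exp (ε * k))) * cylCount d M (m + k) y := by gcongr
      _ = _ := by ring

lemma exists_exp_bounds {a : ℕ → ℝ} {β : ℝ} (ha : ∀ n, 0 < a n)
    (h : Tendsto (fun n : ℕ => Real.log (a n) / n) atTop (𝓝 β)) {ε : ℝ} (hε : 0 < ε) :
    ∃ C > 0, ∀ n : ℕ, a n ≤ C * Real.exp ((β + ε) * n) ∧ Real.exp ((β - ε) * n) ≤ C * a n := by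
  have hev : ∀ᶠ n : ℕ in atTop, a n / Real.exp ((β + ε) * n) +
      Real.exp ((β - ε) * n) / a n ≤ 2 := by
    filter_upwards [h.eventually_lt_const (show β < β + ε by linarith),
      h.eventually_const_lt (show β - ε < β by linarith), eventually_gt_atTop 0] with n h1 h2 hn
    have hn' : (0 : ℝ) < n := Nat.cast_pos.mpr hn
    rw [div_lt_iff₀ hn'] at h1
    rw [lt_div_iff₀ hn'] at h2
    have h3 : a n / Real.exp ((β + ε) * n) ≤ 1 := by
      rw [div_le_one (Real.exp_pos _), ← Real.exp_log (ha n)]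
      exact Real.exp_le_exp.mpr h1.le
    have h4 : Real.exp ((β - ε) * n) / a n ≤ 1 := by
      rw [div_le_one (ha n), ← Real.exp_log (ha n)]
      exact Real.exp_le_exp.mpr h2.le
    linarith
  obtain ⟨C, hC⟩ := (isBoundedUnder_of_eventually_le hev).bddAbove_range
  have hC' : ∀ n : ℕ, a n / Real.exp ((β + ε) * n) + Real.exp ((β - ε) * n) / a n ≤ C :=
    fun n => hC ⟨n, rfl⟩
  have hpos : ∀ n : ℕ, 0 < a n / Real.exp ((β + ε) * n) ∧ 0 < Real.exp ((β - ε) * n) / a n :=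
    fun n => ⟨div_pos (ha n) (Real.exp_pos _), div_pos (Real.exp_pos _) (ha n)⟩
  refine ⟨C, by linarith [hC' 0, (hpos 0).1, (hpos 0).2], fun n => ⟨?_, ?_⟩⟩
  · rw [← div_le_iff₀ (Real.exp_pos _)]
    linarith [hC' n, (hpos n).2]
  · rw [← div_le_iff₀ (ha n)]
    linarith [hC' n, (hpos n).1]

lemma slice_dimensions (hf : IsGasketHeight f d) (hd : IsDigitSystem d M)
    (hΔ : IsSierpinskiGasket Δ) {y β : ℝ} (hβ : 0 ≤ β) (h0 : 0 ≤ y) (hM : y < M)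
    (hy : ∀ (n : ℕ) (m : ℤ), 2 ^ n * y ≠ m)
    (hlim : Tendsto (fun n : ℕ => Real.log (fiberSum d M n y) / n) atTop (𝓝 β))
    (hcmp : ∀ ε > 0, ∃ C > 0, ∀ k n : ℕ, fiberSum d M n (2 ^ k * y) ≤
      C * Real.exp (ε * k) * fiberMin d M n (2 ^ k * y)) :
    lowerBoxDim {z ∈ Δ | f z = y} = β / Real.log 2 ∧
      upperBoxDim {z ∈ Δ | f z = y} = β / Real.log 2 ∧
      dimH {z ∈ Δ | f z = y} = ENNReal.ofReal (β / Real.log 2) := by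
  obtain ⟨R, hR0, hR⟩ := hΔ.2.1.isBounded.subset_closedBall_lt 0 0
  have hpos : ∀ n, 0 < fiberSum d M n y := fun n => one_pos.trans_le (one_le_fiberSum hd n y)
  have hup : ∀ ε > 0, ∃ C > 0, ∀ n : ℕ, ∃ F : Finset (ℝ × ℝ),
      (F.card : ℝ) ≤ C * Real.exp ((β + ε) * n) ∧
        {z ∈ Δ | f z = y} ⊆ ⋃ x ∈ F, closedBall x (R / 2 ^ n) := by
    intro ε hε
    obtain ⟨C, hC, h⟩ := exists_exp_bounds hpos hlim hε
    refine ⟨C, hC, fun n => ?_⟩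
    obtain ⟨F, hFc, hF⟩ := exists_slice_cover hf hd hΔ hR n hy
    exact ⟨F, (hFc.trans (cylCount_le_fiberSum hd n y)).trans (h n).1, hF⟩
  have hlow : ∀ ε > 0, ∃ C > 0, ∃ ν : Measure (ℝ × ℝ), 1 ≤ ν {z ∈ Δ | f z = y} ∧
      ∀ (k : ℕ) x, ν (ball x (1 / 2 ^ k)) ≤ ENNReal.ofReal (C * Real.exp (-(β - ε) * k)) := by
    intro ε hε
    obtain ⟨C, hC, h⟩ := exists_exp_bounds hpos hlim (half_pos hε)
    obtain ⟨D, hD, hcmp⟩ := hcmp (ε / 2) (half_pos hε)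
    obtain ⟨ν, hν, hball⟩ := exists_slice_measure hf hd hΔ h0 hM hD hcmp
    refine ⟨25 * D * (C * D), by positivity, ν, hν, fun k x => (hball k x).trans ?_⟩
    refine ENNReal.ofReal_le_ofReal ?_
    have hk : 0 < cylCount d M k y := one_pos.trans_le (one_le_cylCount hd k h0 hM)
    have h1 : Real.exp ((β - ε / 2) * k) ≤ C * D * cylCount d M k y := by
      refine (h k).2.trans ?_
      have h2 := hcmp 0 k
      rw [pow_zero, one_mul, Nat.cast_zero, mul_zero, Real.exp_zero, mul_one] at h2
      rw [mul_assoc]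
      gcongr
      exact h2.trans (mul_le_mul_of_nonneg_left (fiberMin_le_cylCount k h0 hM) hD.le)
    have e : Real.exp (ε / 2 * k) = Real.exp ((β - ε / 2) * k) * Real.exp (-(β - ε) * k) := by
      rw [← Real.exp_add]; ring_nf
    rw [div_le_iff₀ hk, e]
    calc 25 * (D * (Real.exp ((β - ε / 2) * k) * Real.exp (-(β - ε) * k)))
        ≤ 25 * (D * (C * D * cylCount d M k y * Real.exp (-(β - ε) * k))) := by gcongr
      _ = _ := by ring
  have hbox := tendsto_coverNum hβ hR0 hup hlow
  exact ⟨hbox.liminf_eq, hbox.limsup_eq,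
    le_antisymm (dimH_le_of_covers hβ hR0 hup) (le_dimH_of_measure hlow)⟩

end Slices

section Reduction

lemma exists_gasketHeight {p q : ℕ} (hp : 0 < p) {θ : ℝ}
    (hθ : θ ∈ Ioo 0 (Real.pi / 3)) (hθtan : Real.tan θ = Real.sqrt 3 * p / (2 * q + p)) :
    ∃ (d : Fin 3 → ℕ) (M : ℕ) (κ : ℝ), IsDigitSystem d M ∧ 0 < κ ∧
      IsGasketHeight (fun z => projAngle θ z / κ) d := by
  have hcos : 0 < Real.cos θ := Real.cos_pos_of_mem_Ioo
    ⟨by linarith [hθ.1, Real.pi_pos], by linarith [hθ.2, Real.pi_pos]⟩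
  have hg : 0 < Nat.gcd (2 * q + p) (q + 2 * p) := Nat.gcd_pos_of_pos_left _ (by omega)
  obtain ⟨a, ha⟩ := Nat.gcd_dvd_left (2 * q + p) (q + 2 * p)
  obtain ⟨b, hb⟩ := Nat.gcd_dvd_right (2 * q + p) (q + 2 * p)
  have hab : Nat.Coprime a b := by
    have := Nat.coprime_div_gcd_div_gcd hg
    rwa [Nat.div_eq_of_eq_mul_right hg ha, Nat.div_eq_of_eq_mul_right hg hb] at this
  set g := Nat.gcd (2 * q + p) (q + 2 * p)
  have ha0 : 0 < a := Nat.pos_of_ne_zero fun h => by rw [h] at ha; omega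
  have haR : (2 * q + p : ℝ) = g * a := by exact_mod_cast ha
  have hbR : (q + 2 * p : ℝ) = g * b := by exact_mod_cast hb
  have hgR : (0 : ℝ) < g := Nat.cast_pos.mpr hg
  have ha0R : (0 : ℝ) < a := Nat.cast_pos.mpr ha0
  have h3 : Real.sqrt 3 * Real.sqrt 3 = 3 := Real.mul_self_sqrt (by norm_num)
  have hsin : Real.sin θ = Real.cos θ * (Real.sqrt 3 * p) / (g * a) := by
    rw [← haR, mul_div_assoc, ← hθtan, Real.tan_eq_sin_div_cos, mul_div_cancel₀ _ hcos.ne']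
  refine ⟨![0, a, b], max a b, Real.cos θ / a, ⟨rfl, ?_, by positivity, ?_, ?_⟩,
    by positivity, ⟨?_, ?_, ?_⟩⟩
  · intro i; fin_cases i <;> simp
  · rcases le_total a b with h | h
    · exact ⟨2, by simp [h]⟩
    · exact ⟨1, by simp [h]⟩
  · rcases le_total a b with h | h
    · exact ⟨1, by simpa [h] using hab⟩
    · exact ⟨2, by simpa [h] using hab.symm⟩
  · unfold projAngle; fun_prop
  · simp [projAngle]
  · intro i z
    have hp' : (g : ℝ) * a + 3 * p = 2 * (g * b) := by rw [← haR, ← hbR]; ring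
    fin_cases i
    · simp [projAngle, gasketMap]; ring
    · simp [projAngle, gasketMap]; field_simp; ring
    · simp [projAngle, gasketMap, hsin]
      field_simp
      linear_combination 2 * hp' + 2 * (p : ℝ) * h3

lemma ae_div_of_ae {κ : ℝ} (hκ : κ ≠ 0) {P : ℝ → Prop} (h : ∀ᵐ x : ℝ, P x) :
    ∀ᵐ a : ℝ, P (a / κ) := by
  rw [ae_iff] at h ⊢
  have := Real.volume_preimage_mul_right (inv_ne_zero hκ) {x | ¬ P x}
  rw [h, mul_zero] at this
  simp only [div_eq_mul_inv]
  exact this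

lemma ae_two_pow_mul_ne : ∀ᵐ x : ℝ, ∀ (n : ℕ) (m : ℤ), 2 ^ n * x ≠ m := by
  refine ae_all_iff.mpr fun n => ae_all_iff.mpr fun m => ?_
  filter_upwards [Measure.ae_ne volume ((m : ℝ) / 2 ^ n)] with x hx h
  exact hx (by rw [← h]; field_simp)

end Reduction

/-- **Theorem (Lebesgue-typical slices).** If `tan θ = √3 p/(2q+p)` with `p, q` coprime
positive integers and `θ ∈ (0, π/3)`, then there is a constant `α(θ) < s - 1` such that
for Lebesgue-almost all `a ∈ Δ_θ` the box and Hausdorff dimensions of `E_{θ,a}` exist,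
coincide and equal `α(θ)`. -/
theorem gasket_slice_lebesgue_typical
    (Δ : Set (ℝ × ℝ)) (hΔ : IsSierpinskiGasket Δ)
    (p q : ℕ) (hp : 0 < p) (hq : 0 < q) (hpq : Nat.Coprime p q)
    (θ : ℝ) (hθ : θ ∈ Set.Ioo 0 (Real.pi / 3))
    (hθtan : Real.tan θ = Real.sqrt 3 * p / (2 * q + p)) :
    ∃ α : ℝ, α < Real.log 3 / Real.log 2 - 1 ∧
      ∀ᵐ a ∂(volume.restrict (projAngle θ '' Δ)),
        lowerBoxDim (sliceSet Δ θ a) = α ∧ upperBoxDim (sliceSet Δ θ a) = α ∧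
        dimH (sliceSet Δ θ a) = ENNReal.ofReal α := by
  obtain ⟨d, M, κ, hd, hκ, hf⟩ := exists_gasketHeight hp hθ hθtan
  obtain ⟨β, hβ0, hβ, hae⟩ := exists_growth_rate hd
  have hl2 : 0 < Real.log 2 := Real.log_pos (by norm_num)
  refine ⟨β / Real.log 2, ?_, ?_⟩
  · rw [Real.log_div (by norm_num) (by norm_num)] at hβ
    rw [div_lt_iff₀ hl2, sub_mul, div_mul_cancel₀ _ hl2.ne', one_mul]
    exact hβ
  have hproj : Continuous (projAngle θ) := by unfold projAngle; fun_prop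
  have hmeas : MeasurableSet (projAngle θ '' Δ) :=
    (hΔ.2.1.image hproj).isClosed.measurableSet
  filter_upwards [ae_restrict_of_ae (ae_div_of_ae hκ.ne' hae),
    ae_restrict_of_ae (ae_div_of_ae hκ.ne' ae_two_pow_mul_ne), ae_restrict_mem hmeas]
    with a ha hdyadic hmem
  obtain ⟨z, hz, hza⟩ := hmem
  have hz' := hf.mem_Icc hd hΔ hz
  simp only [hza] at hz'
  have hE : sliceSet Δ θ a = {z ∈ Δ | projAngle θ z / κ = a / κ} := by
    ext w
    simp only [sliceSet, mem_ofPred_eq, div_left_inj' hκ.ne']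
  rw [hE]
  exact slice_dimensions hf hd hΔ hβ0 hz'.1
    (lt_of_le_of_ne hz'.2 fun e => hdyadic 0 M (by simpa using e)) hdyadic ha.1 ha.2

end
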